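/- arXiv:1511.02387 — 4 statements merged into one kernel-verified Lean document; each statement's English description precedes it below -/
import Mathlib

section
/- For every real number ℓ > 0 there exists N such that for every n ≥ N there exists an irreducible finite-dimensional complex representation V of the symmetric group S_n with the following property: every irreducible representation of S_n that is a constituent of τ_n^{⊗ ⌊ℓ·√n⌋} is also a constituent of V ⊗ V. -/
open CategoryTheory MonoidalCategory

/-- `tpow V k` is the `k`-fold tensor power `V ⊗ ⋯ ⊗ V` in `FDRep ℂ G`. -/
noncomputable def tpow {G : Type} [Monoid G] (V : FDRep ℂ G) : ℕ → FDRep ℂ G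
  | 0 => 𝟙_ (FDRep ℂ G)
  | k + 1 => tpow V k ⊗ V

/-- The standard permutation representation `τ_n` of `S_n` on `ℂ^n`
(realised on `Fin n →₀ ℂ`, with `S_n` permuting the coordinates). -/
noncomputable def stdRep (n : ℕ) : FDRep ℂ (Equiv.Perm (Fin n)) :=
  FDRep.of (Representation.ofMulAction ℂ (Equiv.Perm (Fin n)) (Fin n))

/-- The number of occurrences of each letter in a word. -/
def wordContent {n A : ℕ} (w : Fin n → Fin A) (i : Fin A) : ℕ :=
  (Finset.univ.filter fun t => w t = i).card

/-- The permutation representation of `S_n` on functions on words of length `n`. -/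
def wordRep (n A : ℕ) :
    Representation ℂ (Equiv.Perm (Fin n)) ((Fin n → Fin A) → ℂ) where
  toFun σ := LinearMap.funLeft ℂ ℂ fun w => w ∘ σ
  map_one' := rfl
  map_mul' _ _ := rfl

@[simp]
lemma wordRep_apply {n A : ℕ} (σ : Equiv.Perm (Fin n)) (f : (Fin n → Fin A) → ℂ)
    (w : Fin n → Fin A) : wordRep n A σ f w = f (w ∘ σ) := rfl

lemma wordContent_comp {n A : ℕ} (w : Fin n → Fin A) (σ : Equiv.Perm (Fin n)) :
    wordContent (w ∘ σ) = wordContent w := by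
  ext i
  refine Finset.card_bij (fun t _ => σ t) (by simp) (by simp) fun t ht => ⟨σ.symm t, ?_, ?_⟩
  · simpa using ht
  · simp

lemma exists_perm_of_wordContent_eq {n A : ℕ} {v w : Fin n → Fin A}
    (h : wordContent v = wordContent w) : ∃ σ : Equiv.Perm (Fin n), v = w ∘ σ := by
  have e (i : Fin A) : Nonempty ({t // v t = i} ≃ {t // w t = i}) := by
    refine ⟨Fintype.equivOfCardEq ?_⟩
    have := congrFun h i
    simpa [wordContent, Fintype.card_subtype] using this
  exact ⟨Equiv.ofFiberEquiv fun i => (e i).some,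
    funext fun t => (Equiv.ofFiberEquiv_map _ t).symm⟩

lemma update_comp_perm {n A : ℕ} (u : Fin n → Fin A) (σ : Equiv.Perm (Fin n)) (t : Fin n)
    (j : Fin A) : Function.update u t j ∘ σ = Function.update (u ∘ σ) (σ.symm t) j := by
  ext s
  simp only [Function.comp_apply, Function.update_apply, Equiv.eq_symm_apply]

/-- The raising operator on functions on words, replacing letters `j` by `i`. -/
def raising {n A : ℕ} (i j : Fin A) :
    ((Fin n → Fin A) → ℂ) →ₗ[ℂ] ((Fin n → Fin A) → ℂ) where
  toFun f u := ∑ t with u t = i, f (Function.update u t j)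
  map_add' f g := by ext; simp [Finset.sum_add_distrib]
  map_smul' c f := by ext; simp [Finset.mul_sum]

lemma raising_apply {n A : ℕ} (i j : Fin A) (f : (Fin n → Fin A) → ℂ) (u : Fin n → Fin A) :
    raising i j f u = ∑ t with u t = i, f (Function.update u t j) := rfl

lemma raising_wordRep {n A : ℕ} (i j : Fin A) (σ : Equiv.Perm (Fin n))
    (f : (Fin n → Fin A) → ℂ) :
    raising i j (wordRep n A σ f) = wordRep n A σ (raising i j f) := by
  ext u
  simp only [raising_apply, wordRep_apply, update_comp_perm]
  refine Finset.sum_bij (fun t _ => σ.symm t) (by simp) (by simp)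
    (fun t ht => ⟨σ t, by simpa using ht, by simp⟩) (by simp)

/-- Highest weight vectors of weight `lam` in the space of functions on words. -/
def highestWeight {A : ℕ} (n : ℕ) (lam : Fin A → ℕ) : Subrepresentation (wordRep n A) where
  toSubmodule :=
    { carrier := {f | (∀ w, wordContent w ≠ lam → f w = 0) ∧ ∀ i j, i < j → raising i j f = 0}
      add_mem' := fun hf hg => ⟨fun w hw => by simp [hf.1 w hw, hg.1 w hw],
        fun i j hij => by simp [hf.2 i j hij, hg.2 i j hij]⟩
      zero_mem' := by simp
      smul_mem' := fun c f hf => ⟨fun w hw => by simp [hf.1 w hw],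
        fun i j hij => by simp [hf.2 i j hij]⟩ }
  apply_mem_toSubmodule σ f hf := by
    refine ⟨fun w hw => hf.1 _ (by rwa [wordContent_comp]), fun i j hij => ?_⟩
    rw [raising_wordRep, hf.2 i j hij, map_zero]

/-- A highest weight vector invariant under the stabilizer of a word of its weight is determined
by its value at this word. -/
lemma highestWeight_eq_zero {n A : ℕ} {w₀ : Fin n → Fin A} {f : (Fin n → Fin A) → ℂ}
    (hf : f ∈ (highestWeight n (wordContent w₀)).toSubmodule)
    (hinv : ∀ σ : Equiv.Perm (Fin n), w₀ ∘ σ = w₀ → ∀ w, f (w ∘ σ) = f w)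
    (h0 : f w₀ = 0) : f = 0 := by
  classical
  by_contra hne
  obtain ⟨v, hv⟩ := Function.ne_iff.1 hne
  obtain ⟨w, hwS, hmax⟩ := Finset.exists_max_image (Finset.univ.filter fun w => f w ≠ 0)
    (fun w => ∑ t, (w t : ℕ) * (w₀ t : ℕ)) ⟨v, by simpa using hv⟩
  have hw : f w ≠ 0 := by simpa using hwS
  have hcont : wordContent w = wordContent w₀ := by
    by_contra h
    exact hw (hf.1 w h)
  have hww : ∃ t, w t ≠ w₀ t := by
    by_contra! h
    exact hw (by rw [funext h, h0])
  obtain ⟨s, hs⟩ := hww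
  obtain ⟨t₀, ht₀, hmin⟩ := Finset.exists_min_image (Finset.univ.filter fun t => w t ≠ w₀ t)
    (fun t => w₀ t) ⟨s, by simpa using hs⟩
  replace ht₀ : w t₀ ≠ w₀ t₀ := by simpa using ht₀
  have hlow : ∀ t, w₀ t < w₀ t₀ → w t = w₀ t := by
    intro t ht
    by_contra h
    exact absurd (hmin t (by simpa using h)) (not_le.2 ht)
  have hlow' : ∀ t, w t < w₀ t₀ → w₀ t = w t := by
    intro t ht
    have hsub : (Finset.univ.filter fun s => w₀ s = w t) ⊆
        Finset.univ.filter fun s => w s = w t := by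
      intro s hs
      simp only [Finset.mem_filter, Finset.mem_univ, true_and] at hs ⊢
      rw [hlow s (hs ▸ ht), hs]
    have heq := Finset.eq_of_subset_of_card_le hsub (congrFun hcont (w t)).le
    have : t ∈ Finset.univ.filter fun s => w s = w t := by simp
    rw [← heq] at this
    simpa using this
  have hlt : w₀ t₀ < w t₀ := by
    refine lt_of_le_of_ne (not_lt.1 fun h => ?_) (Ne.symm ht₀)
    exact ht₀ (hlow' t₀ h).symm
  have hsum := congrFun (hf.2 _ _ hlt) (Function.update w t₀ (w₀ t₀))
  rw [raising_apply] at hsum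
  have hterm : ∀ t ∈ Finset.univ.filter (fun t => Function.update w t₀ (w₀ t₀) t = w₀ t₀),
      f (Function.update (Function.update w t₀ (w₀ t₀)) t (w t₀)) =
        if w₀ t = w₀ t₀ then f w else 0 := by
    intro t ht
    replace ht : Function.update w t₀ (w₀ t₀) t = w₀ t₀ := by simpa using ht
    by_cases htt : t = t₀
    · subst htt; simp
    have hwt : w t = w₀ t₀ := by simpa [htt] using ht
    split_ifs with hp
    · rw [← hinv (Equiv.swap t t₀) _ w]
      · congr 1
        ext s
        by_cases h1 : s = t
        · subst h1; simp
        · by_cases h2 : s = t₀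
          · subst h2; simp [h1, hwt]
          · simp [h1, h2, Equiv.swap_apply_of_ne_of_ne]
      · ext s
        by_cases h1 : s = t
        · subst h1; simp [hp]
        · by_cases h2 : s = t₀
          · subst h2; simp [hp]
          · simp [Equiv.swap_apply_of_ne_of_ne h1 h2]
    · have hgt : w₀ t₀ < w₀ t := by
        refine lt_of_le_of_ne (not_lt.1 fun h => ?_) (Ne.symm hp)
        have := hlow t h
        rw [hwt] at this
        exact h.ne this.symm
      by_contra hne
      have hle := hmax _ (by simpa using hne)
      refine absurd hle (not_le.2 ?_)
      rw [← Finset.add_sum_erase _ _ (Finset.mem_univ t₀), ← Finset.add_sum_erase _ _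
        (show t ∈ Finset.univ.erase t₀ by simp [htt])]
      conv_rhs => rw [← Finset.add_sum_erase _ _ (Finset.mem_univ t₀), ← Finset.add_sum_erase _ _
        (show t ∈ Finset.univ.erase t₀ by simp [htt])]
      have hrest : ∀ s ∈ (Finset.univ.erase t₀).erase t,
          ((Function.update (Function.update w t₀ (w₀ t₀)) t (w t₀) s : Fin A) : ℕ) * (w₀ s : ℕ) =
            (w s : ℕ) * (w₀ s : ℕ) := by
        intro s hs
        simp only [Finset.mem_erase] at hs
        simp [hs.1, hs.2.1]
      rw [Finset.sum_congr rfl hrest]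
      simp only [Function.update_self, Function.update_of_ne (Ne.symm htt), hwt]
      have h1 : (w₀ t₀ : ℕ) < w t₀ := hlt
      have h2 : (w₀ t₀ : ℕ) < w₀ t := hgt
      nlinarith
  rw [Finset.sum_congr rfl hterm, ← Finset.sum_filter, Finset.sum_const, Pi.zero_apply,
    smul_eq_zero] at hsum
  rcases hsum with h | h
  · rw [Finset.card_eq_zero] at h
    exact Finset.notMem_empty t₀ (h ▸ by simp)
  · exact hw h

namespace FDRep

variable {G : Type} [Group G]

/-- The morphism of representations given by an equivariant linear map. -/
def homOfLinear {X Y : FDRep ℂ G} (φ : X →ₗ[ℂ] Y)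
    (h : ∀ g x, φ (X.ρ g x) = Y.ρ g (φ x)) : X ⟶ Y :=
  ⟨InducedCategory.homMk (ModuleCat.ofHom φ), fun g => by
    ext x
    exact h g x⟩

/-- The linear map underlying a morphism of representations. -/
def linearOfHom {X Y : FDRep ℂ G} (f : X ⟶ Y) : X →ₗ[ℂ] Y := f.hom.hom.hom

lemma linearOfHom_ρ {X Y : FDRep ℂ G} (f : X ⟶ Y) (g : G) (x : X) :
    linearOfHom f (X.ρ g x) = Y.ρ g (linearOfHom f x) :=
  ConcreteCategory.congr_hom ((forget (FGModuleCat ℂ)).congr_map (f.comm g)) x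

lemma hom_ext_linear {X Y : FDRep ℂ G} {f g : X ⟶ Y} (h : linearOfHom f = linearOfHom g) :
    f = g := by
  apply Action.Hom.ext
  ext x
  exact LinearMap.congr_fun h x

lemma linearOfHom_zero (X Y : FDRep ℂ G) : linearOfHom (0 : X ⟶ Y) = 0 := rfl

lemma tensor_ρ_tmul (X Y : FDRep ℂ G) (g : G) (x : X) (y : Y) :
    (X ⊗ Y).ρ g (TensorProduct.tmul ℂ x y) = TensorProduct.tmul ℂ (X.ρ g x) (Y.ρ g y) := rfl

lemma exists_retraction [Finite G] {V : Type} [AddCommGroup V] [Module ℂ V] [Module.Finite ℂ V]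
    {ρ : Representation ℂ G V} (S : Subrepresentation ρ) :
    ∃ π : V →ₗ[ℂ] S.toSubmodule, (∀ x : S.toSubmodule, π x = x) ∧
      ∀ g x, (π (ρ g x) : V) = ρ g (π x) := by
  let ι : FDRep.of S.toRepresentation ⟶ FDRep.of ρ :=
    homOfLinear S.toSubmodule.subtype fun _ _ => rfl
  have hι : Mono ι := by
    have : Mono ((forget (FDRep ℂ G)).map ι) :=
      (mono_iff_injective _).2 Subtype.val_injective
    exact (forget (FDRep ℂ G)).mono_of_mono_map this
  let p := Injective.factorThru (𝟙 _) ι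
  have hp : ι ≫ p = 𝟙 _ := Injective.comp_factorThru _ _
  refine ⟨linearOfHom p, fun x => ?_, fun g x => ?_⟩
  · exact LinearMap.congr_fun (congrArg linearOfHom hp) x
  · exact congrArg Subtype.val (linearOfHom_ρ p g x)

end FDRep

/-- The representation of `S_n` on highest weight vectors. -/
noncomputable abbrev weightRep {A : ℕ} (n : ℕ) (lam : Fin A → ℕ) : FDRep ℂ (Equiv.Perm (Fin n)) :=
  FDRep.of (highestWeight n lam).toRepresentation

lemma wordRep_single {n A : ℕ} (σ : Equiv.Perm (Fin n)) (w : Fin n → Fin A) :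
    wordRep n A σ (Pi.single (w ∘ σ) 1) = Pi.single w 1 := by
  ext v
  simp only [wordRep_apply, Pi.single_apply, σ.surjective.injective_comp_right.eq_iff]

lemma sum_smul_map_single {n A : ℕ} {M : Type*} [AddCommGroup M] [Module ℂ M]
    (π : ((Fin n → Fin A) → ℂ) →ₗ[ℂ] M) (f : (Fin n → Fin A) → ℂ) :
    ∑ w, f w • π (Pi.single w 1) = π f := by
  conv_rhs => rw [pi_eq_sum_univ' f, map_sum]
  refine Finset.sum_congr rfl fun w _ => ?_
  rw [map_smul]

open FDRep in
lemma simple_weightRep {n A : ℕ} {w₀ : Fin n → Fin A}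
    (hne : (highestWeight n (wordContent w₀)).toSubmodule ≠ ⊥) :
    Simple (weightRep n (wordContent w₀)) := by
  have hcard : NeZero (Nat.card (Equiv.Perm (Fin n)) : ℂ) :=
    ⟨Nat.cast_ne_zero.2 Nat.card_pos.ne'⟩
  set S := highestWeight n (wordContent w₀)
  obtain ⟨π, hπ, hπρ⟩ := exists_retraction S
  set v₀ : S.toSubmodule := π (Pi.single w₀ 1)
  have hv₀ : ∀ σ : Equiv.Perm (Fin n), w₀ ∘ σ = w₀ → S.toRepresentation σ v₀ = v₀ := by
    intro σ hσ
    have := hπρ σ (Pi.single (w₀ ∘ σ) 1)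
    rw [wordRep_single] at this
    refine Subtype.ext ?_
    rw [hσ] at this
    exact this.symm
  have hspan : ∀ f : S.toSubmodule, f = ∑ w, (f : (Fin n → Fin A) → ℂ) w • π (Pi.single w 1) :=
    fun f => by rw [sum_smul_map_single, hπ]
  have htrans : ∀ σ : Equiv.Perm (Fin n),
      S.toRepresentation σ (π (Pi.single (w₀ ∘ σ) 1)) = v₀ := by
    intro σ
    refine Subtype.ext ?_
    have := hπρ σ (Pi.single (w₀ ∘ σ) 1)
    rw [wordRep_single] at this
    exact this.symm
  have key : ∀ φ : weightRep n (wordContent w₀) ⟶ weightRep n (wordContent w₀),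
      linearOfHom φ v₀ = (0 : S.toSubmodule) → φ = 0 := by
    intro φ hφ
    apply hom_ext_linear
    rw [linearOfHom_zero]
    refine LinearMap.ext fun f => ?_
    rw [LinearMap.zero_apply]
    have h1 := congrArg (linearOfHom φ) (hspan f)
    refine h1.trans ?_
    rw [map_sum]
    refine Finset.sum_eq_zero fun w _ => ?_
    rw [map_smul]
    by_cases hw : wordContent w = wordContent w₀
    · obtain ⟨σ, rfl⟩ := exists_perm_of_wordContent_eq hw
      have h2 := linearOfHom_ρ φ σ (π (Pi.single (w₀ ∘ σ) 1))
      have h3 : (weightRep n (wordContent w₀)).ρ σ (π (Pi.single (w₀ ∘ σ) 1)) = v₀ := htrans σ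
      rw [h3, hφ] at h2
      have h4 := congrArg ((weightRep n (wordContent w₀)).ρ σ⁻¹) h2
      rw [Representation.inv_self_apply, map_zero] at h4
      rw [← h4, smul_zero]
    · rw [show (f : (Fin n → Fin A) → ℂ) w = 0 from f.2.1 w hw, zero_smul]
  have hid : 𝟙 (weightRep n (wordContent w₀)) ≠ 0 := by
    intro h
    obtain ⟨f, hf, hf0⟩ := Submodule.exists_mem_ne_zero_of_ne_bot hne
    exact hf0 (congrArg Subtype.val (LinearMap.congr_fun (congrArg linearOfHom h) ⟨f, hf⟩))
  have hzero : ∀ f : S.toSubmodule, (∀ σ : Equiv.Perm (Fin n), w₀ ∘ σ = w₀ →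
      S.toRepresentation σ f = f) → (f : (Fin n → Fin A) → ℂ) w₀ = 0 → f = 0 := fun f hf h0 =>
    Subtype.ext (highestWeight_eq_zero f.2
      (fun σ hσ w => congrFun (congrArg Subtype.val (hf σ hσ)) w) h0)
  have hv₀w : (v₀ : (Fin n → Fin A) → ℂ) w₀ ≠ 0 := by
    intro h
    refine hid (key _ ?_)
    exact hzero v₀ hv₀ h
  rw [simple_iff_end_is_rank_one, finrank_eq_one_iff_of_nonzero' _ hid]
  intro φ
  let c : ℂ := (linearOfHom φ v₀ : S.toSubmodule).1 w₀ / (v₀ : (Fin n → Fin A) → ℂ) w₀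
  refine ⟨c, ?_⟩
  rw [eq_comm, ← sub_eq_zero]
  apply key
  have hφv : ∀ σ : Equiv.Perm (Fin n), w₀ ∘ σ = w₀ →
      S.toRepresentation σ (linearOfHom φ v₀ : S.toSubmodule) = linearOfHom φ v₀ := fun σ hσ =>
    (linearOfHom_ρ φ σ v₀).symm.trans (congrArg (linearOfHom φ) (hv₀ σ hσ))
  change (linearOfHom φ v₀ : S.toSubmodule) - c • v₀ = 0
  refine hzero _ (fun σ hσ => ?_) ?_
  · rw [map_sub, map_smul, hφv σ hσ, hv₀ σ hσ]
  · change (linearOfHom φ v₀ : S.toSubmodule).1 w₀ - c * (v₀ : (Fin n → Fin A) → ℂ) w₀ = 0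
    rw [div_mul_cancel₀ _ hv₀w, sub_self]

lemma star_mem_highestWeight {n A : ℕ} {lam : Fin A → ℕ} {f : (Fin n → Fin A) → ℂ}
    (hf : f ∈ (highestWeight n lam).toSubmodule) : star f ∈ (highestWeight n lam).toSubmodule := by
  refine ⟨fun w hw => by simp [hf.1 w hw], fun i j hij => ?_⟩
  have := congrArg star (hf.2 i j hij)
  rw [star_zero] at this
  rw [← this]
  ext u
  simp [raising_apply]

open FDRep TensorProduct in
/-- An invariant function of three words which is a highest weight vector in each variable gives
a nonzero morphism between the corresponding representations. -/
lemma exists_hom_tensor {n a K : ℕ} {lam : Fin a → ℕ} {mu : Fin K → ℕ}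
    (F : (Fin n → Fin a) → (Fin n → Fin a) → (Fin n → Fin K) → ℂ)
    (hF : ∀ (σ : Equiv.Perm (Fin n)) u v w, F (u ∘ σ) (v ∘ σ) (w ∘ σ) = F u v w)
    (h1 : ∀ v w, (fun u => F u v w) ∈ (highestWeight n lam).toSubmodule)
    (h2 : ∀ u w, (fun v => F u v w) ∈ (highestWeight n lam).toSubmodule)
    (h3 : ∀ u v, F u v ∈ (highestWeight n mu).toSubmodule)
    (hne : ∃ u v w, F u v w ≠ 0) :
    ∃ T : weightRep n mu ⟶ weightRep n lam ⊗ weightRep n lam, T ≠ 0 := by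
  obtain ⟨π, hπ, hπρ⟩ := exists_retraction (highestWeight n lam)
  let δ : (Fin n → Fin a) → (Fin n → Fin a) → ℂ := fun u => Pi.single u 1
  let T : (highestWeight n mu).toSubmodule →ₗ[ℂ]
      (highestWeight n lam).toSubmodule ⊗[ℂ] (highestWeight n lam).toSubmodule :=
    ∑ u, ∑ v, ∑ w, (F u v w) • ((LinearMap.proj w ∘ₗ
      (highestWeight n mu).toSubmodule.subtype).smulRight (π (δ u) ⊗ₜ[ℂ] π (δ v)))
  have hT : ∀ g : (highestWeight n mu).toSubmodule,
      T g = ∑ u, ∑ v, ∑ w, F u v w • g.1 w • (π (δ u) ⊗ₜ[ℂ] π (δ v)) := by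
    intro g
    simp [T, LinearMap.sum_apply]
  have hπδ : ∀ (σ : Equiv.Perm (Fin n)) u,
      (highestWeight n lam).toRepresentation σ (π (δ (u ∘ σ))) = π (δ u) := by
    intro σ u
    refine Subtype.ext ?_
    have := hπρ σ (δ (u ∘ σ))
    rw [wordRep_single] at this
    exact this.symm
  have hTρ : ∀ (σ : Equiv.Perm (Fin n)) g, T ((highestWeight n mu).toRepresentation σ g) =
      TensorProduct.map ((highestWeight n lam).toRepresentation σ)
        ((highestWeight n lam).toRepresentation σ) (T g) := by
    intro σ g
    simp only [hT, map_sum, map_smul, TensorProduct.map_tmul]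
    let e (A : ℕ) : (Fin n → Fin A) ≃ (Fin n → Fin A) := σ.symm.arrowCongr (Equiv.refl _)
    have he : ∀ A (u : Fin n → Fin A), e A u = u ∘ σ := fun A u => rfl
    conv_rhs => rw [← (e a).sum_comp]
    refine Finset.sum_congr rfl fun u _ => ?_
    conv_rhs => rw [← (e a).sum_comp]
    refine Finset.sum_congr rfl fun v _ => ?_
    conv_rhs => rw [← (e K).sum_comp]
    refine Finset.sum_congr rfl fun w _ => ?_
    simp only [he, hπδ, hF]
    rfl
  refine ⟨homOfLinear T hTρ, fun h0 => ?_⟩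
  have hT0 : T = 0 := congrArg linearOfHom h0
  obtain ⟨u₀, v₀, w₀, hne⟩ := hne
  let g : (highestWeight n mu).toSubmodule := ⟨star (F u₀ v₀), star_mem_highestWeight (h3 u₀ v₀)⟩
  let ev : (Fin n → Fin a) → (highestWeight n lam).toSubmodule →ₗ[ℂ] ℂ := fun u =>
    LinearMap.proj u ∘ₗ (highestWeight n lam).toSubmodule.subtype
  let B := TensorProduct.lift ((LinearMap.mul ℂ ℂ).compl₁₂ (ev u₀) (ev v₀))
  have hB : ∀ x y, B (x ⊗ₜ y) = x.1 u₀ * y.1 v₀ := fun x y => rfl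
  have hproj : ∀ f ∈ (highestWeight n lam).toSubmodule, ∀ u₀,
      ∑ u, f u * (π (δ u)).1 u₀ = f u₀ := by
    intro f hf u₀
    have h4 := congrArg (ev u₀) (sum_smul_map_single π f)
    rw [map_sum] at h4
    simp only [map_smul, smul_eq_mul] at h4
    refine h4.trans ?_
    rw [hπ ⟨f, hf⟩]
    rfl
  have hval : B (T g) = ∑ w, F u₀ v₀ w * star (F u₀ v₀ w) := by
    simp only [hT, map_sum, map_smul, hB, smul_eq_mul]
    have : ∀ w, ∑ u, ∑ v, F u v w * (g.1 w * ((π (δ u)).1 u₀ * (π (δ v)).1 v₀)) =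
        F u₀ v₀ w * star (F u₀ v₀ w) := by
      intro w
      have h5 : ∀ u, ∑ v, F u v w * (g.1 w * ((π (δ u)).1 u₀ * (π (δ v)).1 v₀)) =
          g.1 w * (F u v₀ w * (π (δ u)).1 u₀) := by
        intro u
        rw [← hproj _ (h2 u w) v₀, Finset.sum_mul, Finset.mul_sum]
        refine Finset.sum_congr rfl fun v _ => by ring
      simp only [h5]
      rw [← Finset.mul_sum, hproj _ (h1 v₀ w) u₀, mul_comm]
      rfl
    simp only [← this]
    rw [Finset.sum_comm]
    conv_rhs => rw [Finset.sum_comm]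
    rw [Finset.sum_comm]
    refine Finset.sum_congr rfl fun u _ => ?_
    rw [Finset.sum_comm]
  rw [hT0, LinearMap.zero_apply, map_zero] at hval
  have hre := (Finset.sum_eq_zero_iff_of_nonneg (s := Finset.univ)
    (f := fun w => ‖F u₀ v₀ w‖ ^ 2) (fun w _ => sq_nonneg _)).1 (by
      have h6 := hval.symm
      simp only [← starRingEnd_apply, Complex.mul_conj'] at h6
      exact_mod_cast h6)
  have := hre w₀ (Finset.mem_univ _)
  simp at this
  exact hne this

lemma exists_basis_tpow (n k : ℕ) : ∃ b : Module.Basis (Fin k → Fin n) ℂ (tpow (stdRep n) k),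
    ∀ (σ : Equiv.Perm (Fin n)) x, (tpow (stdRep n) k).ρ σ (b x) = b (σ ∘ x) := by
  induction k with
  | zero =>
    refine ⟨Module.Basis.singleton (Fin 0 → Fin n) ℂ, fun σ x => ?_⟩
    rw [Subsingleton.elim (σ ∘ x) x]
    rfl
  | succ k ih =>
    obtain ⟨b, hb⟩ := ih
    let c : Module.Basis (Fin n) ℂ (stdRep n) := MonoidAlgebra.basis (Fin n) ℂ
    have hc : ∀ (σ : Equiv.Perm (Fin n)) i, (stdRep n).ρ σ (c i) = c (σ i) := by
      intro σ i
      change Representation.ofMulAction ℂ (Equiv.Perm (Fin n)) (Fin n) σ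
        (MonoidAlgebra.basis (Fin n) ℂ i) = MonoidAlgebra.basis (Fin n) ℂ (σ i)
      simp [Representation.ofMulAction_single]
    let e : (Fin k → Fin n) × Fin n ≃ (Fin (k + 1) → Fin n) :=
      (Equiv.prodComm _ _).trans (Fin.snocEquiv fun _ => Fin n)
    have he : ∀ x i, e (x, i) = Fin.snoc x i := fun x i => rfl
    let d : Module.Basis (Fin (k + 1) → Fin n) ℂ (tpow (stdRep n) (k + 1)) :=
      (b.tensorProduct c).reindex e
    have hd : ∀ x i, d (e (x, i)) = TensorProduct.tmul ℂ (b x) (c i) := by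
      intro x i
      change ((b.tensorProduct c).reindex e) _ = _
      rw [Module.Basis.reindex_apply, Equiv.symm_apply_apply, Module.Basis.tensorProduct_apply]
    refine ⟨d, fun σ x => ?_⟩
    obtain ⟨⟨x, i⟩, rfl⟩ := e.surjective x
    have h1 : σ ∘ e (x, i) = e (σ ∘ x, σ i) := by
      rw [he, he, Fin.comp_snoc]
    rw [h1, hd, hd]
    refine (FDRep.tensor_ρ_tmul (tpow (stdRep n) k) (stdRep n) σ (b x) (c i)).trans ?_
    rw [hb, hc]

open FDRep in
/-- A nonzero morphism to a tensor power of the standard representation gives a functional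
fixed by the stabilizer of a tuple. -/
lemma exists_functional_of_hom_tpow {n k : ℕ} {W : FDRep ℂ (Equiv.Perm (Fin n))}
    (f : W ⟶ tpow (stdRep n) k) (hf : f ≠ 0) :
    ∃ (x : Fin k → Fin n) (φ : W →ₗ[ℂ] ℂ), φ ≠ 0 ∧
      ∀ σ : Equiv.Perm (Fin n), σ ∘ x = x → ∀ w, φ (W.ρ σ w) = φ w := by
  obtain ⟨b, hb⟩ := exists_basis_tpow n k
  have hfl : ∃ w, linearOfHom f w ≠ 0 := by
    by_contra! h
    exact hf (hom_ext_linear (LinearMap.ext h))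
  obtain ⟨w, hw⟩ := hfl
  have hx : ∃ x, b.coord x (linearOfHom f w) ≠ 0 := by
    by_contra! h
    exact hw (b.forall_coord_eq_zero_iff.1 h)
  obtain ⟨x, hx⟩ := hx
  refine ⟨x, b.coord x ∘ₗ linearOfHom f, fun h => hx (LinearMap.congr_fun h w), ?_⟩
  intro σ hσ w
  have h1 : b.coord x ∘ₗ (tpow (stdRep n) k).ρ σ = b.coord x := by
    refine b.ext fun y => ?_
    rw [LinearMap.comp_apply, hb, b.coord_apply, b.coord_apply, b.repr_self, b.repr_self]
    conv_lhs => rw [← hσ]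
    rw [Finsupp.single_apply, Finsupp.single_apply]
    simp only [σ.injective.comp_left.eq_iff]
  rw [LinearMap.comp_apply, linearOfHom_ρ, LinearMap.comp_apply]
  exact LinearMap.congr_fun h1 _

/-- An equivariant map to functions on words which does not vanish at a given word. -/
def DetectsWord {n A : ℕ} (W : FDRep ℂ (Equiv.Perm (Fin n))) (z : Fin n → Fin A) : Prop :=
  ∃ ψ : W →ₗ[ℂ] ((Fin n → Fin A) → ℂ),
    (∀ σ w, ψ (W.ρ σ w) = wordRep n A σ (ψ w)) ∧ ∃ w, ψ w z ≠ 0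

lemma exists_detectsWord {n k : ℕ} {W : FDRep ℂ (Equiv.Perm (Fin n))}
    (f : W ⟶ tpow (stdRep n) k) (hf : f ≠ 0) :
    ∃ z : Fin n → Fin (k + 1), (Finset.univ.filter fun t => z t ≠ 0).card ≤ k ∧
      DetectsWord W z := by
  classical
  obtain ⟨x, φ, hφ, hinv⟩ := exists_functional_of_hom_tpow f hf
  let z : Fin n → Fin (k + 1) := fun t => if h : ∃ s, x s = t then h.choose.succ else 0
  have hzx : ∀ t s, z t = Fin.succ s → x s = t := by
    intro t s hs
    by_cases h : ∃ s, x s = t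
    · simp only [z, dif_pos h, Fin.succ_inj] at hs
      rw [← hs]; exact h.choose_spec
    · simp only [z, dif_neg h] at hs
      exact absurd hs.symm (Fin.succ_ne_zero s)
  have hz0 : ∀ s, z (x s) ≠ 0 := by
    intro s
    have h : ∃ s', x s' = x s := ⟨s, rfl⟩
    simp only [z, dif_pos h]
    exact Fin.succ_ne_zero _
  refine ⟨z, ?_, ∑ σ : Equiv.Perm (Fin n), LinearMap.pi fun u =>
    if z ∘ σ = u then φ ∘ₗ W.ρ σ else 0, fun τ w => ?_, ?_⟩
  · have : (Finset.univ.filter fun t => z t ≠ 0) ⊆ Finset.univ.image x := by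
      intro t ht
      obtain ⟨s, hs⟩ := Fin.exists_succ_eq_of_ne_zero (Finset.mem_filter.1 ht).2
      exact Finset.mem_image.2 ⟨s, Finset.mem_univ _, hzx t s hs.symm⟩
    exact (Finset.card_le_card this).trans (Finset.card_image_le.trans (by simp))
  · ext u
    simp only [LinearMap.sum_apply, Finset.sum_apply, wordRep_apply, LinearMap.pi_apply]
    conv_rhs => rw [← Equiv.sum_comp (Equiv.mulRight τ)]
    refine Finset.sum_congr rfl fun σ _ => ?_
    have : z ∘ ⇑(σ * τ) = u ∘ τ ↔ z ∘ σ = u := by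
      rw [Equiv.Perm.coe_mul, ← Function.comp_assoc]
      exact τ.surjective.injective_comp_right.eq_iff
    simp only [Equiv.coe_mulRight, this]
    split_ifs
    · simp
    · rfl
  · obtain ⟨w, hw⟩ := DFunLike.ne_iff.1 hφ
    refine ⟨w, ?_⟩
    simp only [LinearMap.sum_apply, Finset.sum_apply, LinearMap.pi_apply]
    have h1 : ∀ σ : Equiv.Perm (Fin n), (if z ∘ σ = z then φ ∘ₗ W.ρ σ else 0) w =
        if z ∘ σ = z then φ w else 0 := by
      intro σ
      split_ifs with hσ
      · refine hinv σ (funext fun s => ?_) w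
        obtain ⟨s', hs'⟩ := Fin.exists_succ_eq_of_ne_zero (hz0 s)
        exact (hzx _ _ ((congrFun hσ (x s)).trans hs'.symm)).symm.trans (hzx _ _ hs'.symm)
      · rfl
    simp only [h1]
    rw [← Finset.sum_filter, Finset.sum_const]
    refine smul_ne_zero ?_ hw
    rw [Finset.card_ne_zero]
    exact ⟨1, by simp⟩

/-- The number of nonzero letters of a word. -/
def wordSupport {n k : ℕ} (z : Fin n → Fin (k + 1)) : ℕ :=
  (Finset.univ.filter fun t => z t ≠ 0).card

lemma raising_detects {n A : ℕ} {W : FDRep ℂ (Equiv.Perm (Fin n))}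
    {ψ : W →ₗ[ℂ] ((Fin n → Fin A) → ℂ)} (hψ : ∀ σ w, ψ (W.ρ σ w) = wordRep n A σ (ψ w))
    (i j : Fin A) {w : W} {u : Fin n → Fin A} (hu : raising i j (ψ w) u ≠ 0) : DetectsWord W u :=
  ⟨raising i j ∘ₗ ψ, fun σ w => by
    rw [LinearMap.comp_apply, hψ, raising_wordRep, LinearMap.comp_apply], w, hu⟩

lemma DetectsWord.perm_letters {n A : ℕ} {W : FDRep ℂ (Equiv.Perm (Fin n))} {z : Fin n → Fin A}
    (h : DetectsWord W z) (e : Equiv.Perm (Fin A)) : DetectsWord W (e ∘ z) := by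
  obtain ⟨ψ, hψ, w, hw⟩ := h
  refine ⟨LinearMap.funLeft ℂ ℂ (fun u => e.symm ∘ u) ∘ₗ ψ, fun σ w => ?_, w, ?_⟩
  · rw [LinearMap.comp_apply, hψ]; rfl
  · simpa [LinearMap.funLeft_apply, ← Function.comp_assoc] using hw

lemma sum_swap_lt {n A : ℕ} {z : Fin n → Fin A} {i j : Fin A} (hij : i < j)
    (h : wordContent z i < wordContent z j) :
    ∑ t, (Equiv.swap i j (z t) : ℕ) < ∑ t, (z t : ℕ) := by
  have h1 : ∀ t, ((z t : ℕ) : ℤ) - ((Equiv.swap i j (z t) : ℕ) : ℤ) =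
      ((j : ℕ) - (i : ℕ) : ℤ) * ((if z t = j then 1 else 0) - (if z t = i then 1 else 0)) := by
    intro t
    by_cases hi : z t = i
    · simp [hi, hij.ne]
    · by_cases hj : z t = j
      · simp [hj, hij.ne']
      · simp [hi, hj, Equiv.swap_apply_of_ne_of_ne]
  have h2 : ∑ t, ((z t : ℕ) : ℤ) - ∑ t, ((Equiv.swap i j (z t) : ℕ) : ℤ) =
      ((j : ℕ) - (i : ℕ) : ℤ) * ((wordContent z j : ℤ) - wordContent z i) := by
    rw [← Finset.sum_sub_distrib, Finset.sum_congr rfl fun t _ => h1 t, ← Finset.mul_sum,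
      Finset.sum_sub_distrib]
    simp [wordContent]
  have h3 : (0 : ℤ) < ((j : ℕ) - (i : ℕ) : ℤ) * ((wordContent z j : ℤ) - wordContent z i) :=
    mul_pos (sub_pos.2 (by exact_mod_cast hij)) (sub_pos.2 (by exact_mod_cast h))
  zify
  linarith

lemma wordSupport_swap_le {n k : ℕ} {z : Fin n → Fin (k + 1)} {i j : Fin (k + 1)} (hij : i < j)
    (h : wordContent z i < wordContent z j) :
    wordSupport (Equiv.swap i j ∘ z) ≤ wordSupport z := by
  have hj0 : j ≠ 0 := (Fin.zero_le i |>.trans_lt hij).ne'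
  rcases eq_or_ne i 0 with rfl | hi0
  · have e : ∀ w : Fin n → Fin (k + 1), wordContent w 0 + wordSupport w = n := fun w => by
      simpa [wordContent, wordSupport] using
        Finset.card_filter_add_card_filter_not (s := (Finset.univ : Finset (Fin n)))
          fun t => w t = 0
    have h1 := e z
    have h2 := e (Equiv.swap 0 j ∘ z)
    have h3 : wordContent (Equiv.swap 0 j ∘ z) 0 = wordContent z j := by
      simp [wordContent, Equiv.swap_apply_eq_iff]
    omega
  · refine Finset.card_le_card fun t ht => ?_
    simp only [Finset.mem_filter, Finset.mem_univ, true_and, Function.comp_apply] at ht ⊢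
    rwa [Ne, Equiv.swap_apply_eq_iff, Equiv.swap_apply_of_ne_of_ne hi0.symm hj0.symm] at ht

open FDRep in
lemma exists_hom_weightRep {n k : ℕ} {W : FDRep ℂ (Equiv.Perm (Fin n))}
    (f : W ⟶ tpow (stdRep n) k) (hf : f ≠ 0) :
    ∃ z : Fin n → Fin (k + 1), wordSupport z ≤ k ∧ Antitone (wordContent z) ∧
      ∃ g : W ⟶ weightRep n (wordContent z), g ≠ 0 := by
  classical
  obtain ⟨z₀, hz₀, hW₀⟩ := exists_detectsWord f hf
  obtain ⟨z, hz, hmin⟩ := Finset.exists_min_image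
    (Finset.univ.filter fun z : Fin n → Fin (k + 1) => wordSupport z ≤ k ∧ DetectsWord W z)
    (fun z => ∑ t, (z t : ℕ)) ⟨z₀, by simpa using ⟨hz₀, hW₀⟩⟩
  obtain ⟨-, hzk, hzW⟩ := Finset.mem_filter.1 hz
  replace hmin : ∀ u : Fin n → Fin (k + 1), wordSupport u ≤ k → DetectsWord W u →
      ∑ t, (z t : ℕ) ≤ ∑ t, (u t : ℕ) := fun u h1 h2 => hmin u (by simpa using ⟨h1, h2⟩)
  refine ⟨z, hzk, fun i j hij => ?_, ?_⟩
  · by_contra! hlt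
    have hij' : i < j := lt_of_le_of_ne hij (by rintro rfl; exact hlt.false)
    exact (sum_swap_lt hij' hlt).not_ge
      (hmin _ ((wordSupport_swap_le hij' hlt).trans hzk) (hzW.perm_letters _))
  · obtain ⟨ψ, hψ, w, hw⟩ := hzW
    let r : ((Fin n → Fin (k + 1)) → ℂ) →ₗ[ℂ] ((Fin n → Fin (k + 1)) → ℂ) :=
      LinearMap.pi fun u => if wordContent u = wordContent z then LinearMap.proj u else 0
    have hr : ∀ g u, r g u = if wordContent u = wordContent z then g u else 0 := by
      intro g u
      simp only [r, LinearMap.pi_apply]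
      split_ifs <;> rfl
    have hrψ : ∀ σ w, (r ∘ₗ ψ) (W.ρ σ w) = wordRep n (k + 1) σ ((r ∘ₗ ψ) w) := by
      intro σ w
      ext u
      rw [LinearMap.comp_apply, hr, hψ, wordRep_apply, wordRep_apply, LinearMap.comp_apply, hr,
        wordContent_comp]
    have hmem : ∀ w, (r ∘ₗ ψ) w ∈ (highestWeight n (wordContent z)).toSubmodule := by
      intro w
      refine ⟨fun u hu => by rw [LinearMap.comp_apply, hr, if_neg hu], fun i j hij => ?_⟩
      by_contra hne
      obtain ⟨u, hu⟩ := Function.ne_iff.1 hne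
      have hdet := raising_detects hrψ i j hu
      rw [raising_apply] at hu
      obtain ⟨t, ht, htu⟩ := Finset.exists_ne_zero_of_sum_ne_zero hu
      replace ht : u t = i := by simpa using ht
      rw [LinearMap.comp_apply, hr] at htu
      have hcont : wordContent (Function.update u t j) = wordContent z := by
        by_contra h
        exact htu (if_neg h)
      obtain ⟨σ, hσ⟩ := exists_perm_of_wordContent_eq hcont
      have hsum : ∑ s, (Function.update u t j s : ℕ) = ∑ s, (z s : ℕ) := by
        rw [hσ]
        exact Equiv.sum_comp σ fun s => (z s : ℕ)
      have hsupp : wordSupport (Function.update u t j) = wordSupport z := by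
        rw [hσ]
        exact Finset.card_equiv σ (by simp)
      have hle : wordSupport u ≤ wordSupport (Function.update u t j) := by
        refine Finset.card_le_card fun s hs => ?_
        simp only [Finset.mem_filter, Finset.mem_univ, true_and] at hs ⊢
        by_cases hst : s = t
        · subst hst
          rw [Function.update_self]
          exact (Fin.zero_le i |>.trans_lt hij).ne'
        · rwa [Function.update_of_ne hst]
      have hlt : ∑ s, (u s : ℕ) < ∑ s, (Function.update u t j s : ℕ) := by
        refine Finset.sum_lt_sum (fun s _ => ?_) ⟨t, Finset.mem_univ _, ?_⟩
        · by_cases hst : s = t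
          · subst hst
            rw [Function.update_self, ht]
            exact hij.le
          · rw [Function.update_of_ne hst]
        · rw [Function.update_self, ht]
          exact hij
      have := hmin u (by omega) hdet
      omega
    refine ⟨homOfLinear (Y := weightRep n (wordContent z)) ((r ∘ₗ ψ).codRestrict _ hmem)
      fun σ w => Subtype.ext (hrψ σ w), fun h0 => hw ?_⟩
    have h1 := congrFun (congrArg Subtype.val (LinearMap.congr_fun (congrArg linearOfHom h0) w)) z
    have h2 : (r ∘ₗ ψ) w z = 0 := h1
    rwa [LinearMap.comp_apply, hr, if_pos rfl] at h2

lemma highestWeight_ne_bot_of_hom {n A : ℕ} {lam : Fin A → ℕ} {W : FDRep ℂ (Equiv.Perm (Fin n))}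
    {g : W ⟶ weightRep n lam} (hg : g ≠ 0) : (highestWeight n lam).toSubmodule ≠ ⊥ := by
  intro h
  refine hg (FDRep.hom_ext_linear (LinearMap.ext fun w => ?_))
  have : ∀ x : (highestWeight n lam).toSubmodule, x = 0 := fun x =>
    Subtype.ext ((Submodule.eq_bot_iff _).1 h x.1 x.2)
  exact this _

section Polarization

open MvPolynomial

/-- The derivation of `ℂ[x_v]` replacing the index `j` by `i` on the axis `s`. -/
noncomputable def polarization (s : Fin 3) (i j : ℕ) :
    Derivation ℂ (MvPolynomial (Fin 3 → ℕ) ℂ) (MvPolynomial (Fin 3 → ℕ) ℂ) :=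
  mkDerivation ℂ fun v => if v s = j then X (Function.update v s i) else 0

lemma polarization_X (s : Fin 3) (i j : ℕ) (v : Fin 3 → ℕ) :
    polarization s i j (X v) = if v s = j then X (Function.update v s i) else 0 :=
  mkDerivation_X ℂ _ v

lemma polarization_comm {s s' : Fin 3} (h : s ≠ s') (i j i' j' : ℕ)
    (p : MvPolynomial (Fin 3 → ℕ) ℂ) :
    polarization s i j (polarization s' i' j' p) =
      polarization s' i' j' (polarization s i j p) := by
  suffices ⁅polarization s i j, polarization s' i' j'⁆ = 0 by
    have := DFunLike.congr_fun this p
    rwa [Derivation.commutator_apply, Derivation.zero_apply, sub_eq_zero] at this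
  refine derivation_ext fun v => ?_
  rw [Derivation.commutator_apply, Derivation.zero_apply, sub_eq_zero]
  simp only [polarization_X, apply_ite (polarization _ _ _), map_zero,
    Function.update_of_ne h, Function.update_of_ne h.symm, Function.update_comm h]
  split_ifs <;> rfl

lemma polarization_polarization_of_supported {s : Fin 3} {l m l' : ℕ} (h : l < m)
    {p : MvPolynomial (Fin 3 → ℕ) ℂ} (hp : p ∈ supported ℂ {v : Fin 3 → ℕ | v s = 0}) :
    polarization s l m (polarization s l' 0 p) = if l' = m then polarization s l 0 p else 0 := by
  have h0 : polarization s l m p = 0 := by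
    refine derivation_eqOn_supported (D₂ := 0) (fun v hv => ?_) hp
    have hv : v s = 0 := hv
    simp only [Function.comp_apply, polarization_X, hv, Derivation.zero_apply]
    rw [if_neg (by omega)]
  have h1 : ⁅polarization s l m, polarization s l' 0⁆ p =
      (if l' = m then polarization s l 0 else 0 :
        Derivation ℂ (MvPolynomial (Fin 3 → ℕ) ℂ) (MvPolynomial (Fin 3 → ℕ) ℂ)) p := by
    refine derivation_eqOn_supported (fun v hv => ?_) hp
    have hv : v s = 0 := hv
    have hm : 0 ≠ m := by omega
    simp only [Function.comp_apply, Derivation.commutator_apply, polarization_X, hv, if_true,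
      if_neg hm, map_zero, sub_zero, Function.update_self, Function.update_idem]
    split_ifs <;> simp [polarization_X, hv]
  rw [Derivation.commutator_apply, h0, map_zero, sub_zero] at h1
  rw [h1]
  split_ifs <;> rfl

lemma coeff_polarization {s : Fin 3} {i j : ℕ} (p : MvPolynomial (Fin 3 → ℕ) ℂ)
    (m : (Fin 3 → ℕ) →₀ ℕ) : coeff m (polarization s i j p) =
      ∑ u ∈ m.support with u s = i,
        coeff (m - Finsupp.single u 1) (pderiv (Function.update u s j) p) := by
  classical
  let T := p.vars ∪ m.support.image fun u => Function.update u s j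
  have hsum : ∀ (D : (Fin 3 → ℕ) → Derivation ℂ (MvPolynomial (Fin 3 → ℕ) ℂ)
      (MvPolynomial (Fin 3 → ℕ) ℂ)) q, (∑ v ∈ T, D v) q = ∑ v ∈ T, D v q := by
    intro D q
    rw [← Derivation.coeFnAddMonoidHom_apply, map_sum, Finset.sum_apply]
    rfl
  have h1 : polarization s i j p = ∑ v ∈ T, polarization s i j (X v) * pderiv v p := by
    have : polarization s i j p = (∑ v ∈ T, polarization s i j (X v) • pderiv v :
        Derivation ℂ (MvPolynomial (Fin 3 → ℕ) ℂ) (MvPolynomial (Fin 3 → ℕ) ℂ)) p := by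
      refine derivation_eq_of_forall_mem_vars fun v hv => ?_
      have hvT : v ∈ T := Finset.mem_union_left _ hv
      rw [hsum, Finset.sum_eq_single_of_mem v hvT]
      · simp
      · intro u _ huv
        simp [pderiv_X_of_ne huv.symm]
    rw [this, hsum]
    rfl
  rw [h1, coeff_sum]
  have h2 : ∀ v, coeff m (polarization s i j (X v) * pderiv v p) =
      if v s = j ∧ Function.update v s i ∈ m.support then
        coeff (m - Finsupp.single (Function.update v s i) 1) (pderiv v p) else 0 := by
    intro v
    rw [polarization_X]
    by_cases hv : v s = j
    · simp only [hv, if_true, true_and, coeff_X_mul']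
    · simp [hv]
  simp only [h2]
  rw [← Finset.sum_filter]
  refine Finset.sum_nbij' (fun v => Function.update v s i) (fun u => Function.update u s j)
    ?_ ?_ ?_ ?_ ?_
  · intro v hv
    simp only [Finset.mem_filter] at hv ⊢
    simp [hv.2.2]
  · intro u hu
    simp only [Finset.mem_filter] at hu ⊢
    refine ⟨Finset.mem_union_right _ (Finset.mem_image_of_mem _ hu.1), by simp, ?_⟩
    simp [← hu.2, hu.1]
  · intro v hv
    simp only [Finset.mem_filter] at hv
    simp [← hv.2.1]
  · intro u hu
    simp only [Finset.mem_filter] at hu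
    simp [← hu.2]
  · intro v hv
    simp only [Finset.mem_filter] at hv
    simp [← hv.2.1]

/-- The monomial corresponding to a word in the variables. -/
noncomputable def wordMonomial {n : ℕ} (z : Fin n → Fin 3 → ℕ) : (Fin 3 → ℕ) →₀ ℕ :=
  ∑ t, Finsupp.single (z t) 1

/-- The product of the factorials of the exponents of a monomial. -/
noncomputable def exponentFactorial (m : (Fin 3 → ℕ) →₀ ℕ) : ℂ :=
  m.prod fun _ e => (e.factorial : ℂ)

/-- The value of the complete polarization of a polynomial at a word in the variables. -/
noncomputable def wordCoeff {n : ℕ} (p : MvPolynomial (Fin 3 → ℕ) ℂ) (z : Fin n → Fin 3 → ℕ) : ℂ :=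
  exponentFactorial (wordMonomial z) * coeff (wordMonomial z) p

lemma wordMonomial_comp {n : ℕ} (z : Fin n → Fin 3 → ℕ) (σ : Equiv.Perm (Fin n)) :
    wordMonomial (z ∘ σ) = wordMonomial z :=
  Equiv.sum_comp σ fun t => Finsupp.single (z t) 1

lemma wordMonomial_apply {n : ℕ} (z : Fin n → Fin 3 → ℕ) (v : Fin 3 → ℕ) :
    wordMonomial z v = (Finset.univ.filter fun t => z t = v).card := by
  classical
  simp [wordMonomial, Finsupp.finsetSum_apply, Finsupp.single_apply]

lemma exists_wordMonomial {n : ℕ} {m : (Fin 3 → ℕ) →₀ ℕ} (h : m.degree = n) :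
    ∃ z : Fin n → Fin 3 → ℕ, wordMonomial z = m := by
  induction n generalizing m with
  | zero =>
    exact ⟨Fin.elim0, by rw [(Finsupp.degree_eq_zero_iff m).1 h]; rfl⟩
  | succ n ih =>
    have hm : m ≠ 0 := by rintro rfl; simp at h
    obtain ⟨v, hv⟩ := Finsupp.support_nonempty_iff.2 hm
    have hle : Finsupp.single v 1 ≤ m := by
      rw [Finsupp.single_le_iff, Nat.one_le_iff_ne_zero]
      exact Finsupp.mem_support_iff.1 hv
    obtain ⟨m', rfl⟩ := exists_add_of_le hle
    rw [map_add, Finsupp.degree_single] at h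
    obtain ⟨z, rfl⟩ := ih (m := m') (by omega)
    exact ⟨Fin.cons v z, by simp [wordMonomial, Fin.sum_univ_succ]⟩

lemma exponentFactorial_ne_zero (m : (Fin 3 → ℕ) →₀ ℕ) : exponentFactorial m ≠ 0 :=
  Finset.prod_ne_zero_iff.2 fun _ _ => Nat.cast_ne_zero.2 (Nat.factorial_ne_zero _)

lemma exponentFactorial_add_single (m : (Fin 3 → ℕ) →₀ ℕ) (v : Fin 3 → ℕ) :
    exponentFactorial (m + Finsupp.single v 1) = (m v + 1) * exponentFactorial m := by
  classical
  have h0 : ∀ a : Fin 3 → ℕ, ((Nat.factorial 0 : ℕ) : ℂ) = 1 := by simp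
  have hs : m.support ⊆ insert v m.support := Finset.subset_insert _ _
  have hs' : (m + Finsupp.single v 1).support ⊆ insert v m.support := by
    refine Finsupp.support_add.trans (Finset.union_subset hs ?_)
    exact Finsupp.support_single_subset.trans (by simp)
  rw [exponentFactorial, exponentFactorial,
    Finsupp.prod_of_support_subset _ hs' _ (fun a _ => h0 a),
    Finsupp.prod_of_support_subset _ hs _ (fun a _ => h0 a),
    ← Finset.mul_prod_erase _ _ (Finset.mem_insert_self v _),
    ← Finset.mul_prod_erase _ _ (Finset.mem_insert_self v _)]
  rw [Finset.prod_congr rfl fun x hx => by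
    rw [Finsupp.add_apply, Finsupp.single_eq_of_ne (Finset.ne_of_mem_erase hx), add_zero],
    Finsupp.add_apply, Finsupp.single_eq_same, Nat.factorial_succ]
  push_cast
  ring

lemma sum_wordCoeff_update_eq_zero {n : ℕ} {p : MvPolynomial (Fin 3 → ℕ) ℂ} {s : Fin 3} {i j : ℕ}
    (hp : polarization s i j p = 0) (z : Fin n → Fin 3 → ℕ) :
    ∑ t with z t s = i, wordCoeff p (Function.update z t (Function.update (z t) s j)) = 0 := by
  classical
  set m := wordMonomial z with hm
  have hrest : ∀ t, m = ∑ r ∈ Finset.univ.erase t, Finsupp.single (z r) 1 +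
      Finsupp.single (z t) 1 := fun t => by
    rw [Finset.sum_erase_add _ _ (Finset.mem_univ t), hm, wordMonomial]
  have hupd : ∀ t v, wordMonomial (Function.update z t v) =
      m - Finsupp.single (z t) 1 + Finsupp.single v 1 := by
    intro t v
    rw [hrest t, add_tsub_cancel_right, wordMonomial,
      ← Finset.sum_erase_add _ _ (Finset.mem_univ t), Function.update_self]
    congr 1
    refine Finset.sum_congr rfl fun r hr => ?_
    rw [Function.update_of_ne (Finset.ne_of_mem_erase hr)]
  let G : (Fin 3 → ℕ) → ℂ := fun u => exponentFactorial (m - Finsupp.single u 1) *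
    coeff (m - Finsupp.single u 1) (pderiv (Function.update u s j) p)
  have hG : ∀ t, wordCoeff p (Function.update z t (Function.update (z t) s j)) = G (z t) := by
    intro t
    rw [wordCoeff, hupd, exponentFactorial_add_single]
    simp only [G, coeff_pderiv]
    ring
  have hfact : ∀ u ∈ m.support, exponentFactorial m =
      m u * exponentFactorial (m - Finsupp.single u 1) := by
    intro u hu
    have hle : Finsupp.single u 1 ≤ m := by
      rw [Finsupp.single_le_iff, Nat.one_le_iff_ne_zero]
      exact Finsupp.mem_support_iff.1 hu
    obtain ⟨m', h⟩ := exists_add_of_le hle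
    rw [h, add_tsub_cancel_left, add_comm, exponentFactorial_add_single]
    simp
  have hmaps : ∀ t ∈ Finset.univ.filter (fun t => z t s = i),
      z t ∈ m.support.filter fun u => u s = i := by
    intro t ht
    rw [Finset.mem_filter] at ht ⊢
    refine ⟨?_, ht.2⟩
    rw [Finsupp.mem_support_iff, hrest t]
    simp
  simp only [hG]
  rw [← Finset.sum_fiberwise_of_maps_to hmaps]
  have hfib : ∀ u ∈ m.support.filter (fun u => u s = i),
      ∑ t ∈ Finset.univ.filter (fun t => z t s = i) with z t = u, G (z t) =
        exponentFactorial m *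
          coeff (m - Finsupp.single u 1) (pderiv (Function.update u s j) p) := by
    intro u hu
    rw [Finset.mem_filter] at hu
    rw [Finset.sum_congr rfl fun t ht => by rw [(Finset.mem_filter.1 ht).2], Finset.sum_const,
      hfact u hu.1, Finset.filter_filter, Finset.filter_congr (q := fun t => z t = u)
        fun t _ => ⟨fun h => h.2, fun h => ⟨h ▸ hu.2, h⟩⟩, ← wordMonomial_apply, ← hm, nsmul_eq_mul]
    simp only [G]
    ring
  rw [Finset.sum_congr rfl hfib, ← Finset.mul_sum, ← coeff_polarization, hp, coeff_zero, mul_zero]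

lemma Derivation.map_det {R A ι : Type*} [CommRing R] [CommRing A] [Algebra R A] [Fintype ι]
    [DecidableEq ι] (D : Derivation R A A) (M : Matrix ι ι A) :
    D M.det = ∑ k, (M.updateCol k fun i => D (M i k)).det := by
  have hprod : ∀ (s : Finset ι) (f : ι → A),
      D (∏ i ∈ s, f i) = ∑ k ∈ s, ∏ i ∈ s, Function.update f k (D (f k)) i := by
    intro s f
    induction s using Finset.induction_on with
    | empty => simp
    | insert a s ha ih =>
      rw [Finset.prod_insert ha, Derivation.leibniz, ih, Finset.sum_insert ha,
        Finset.prod_insert ha, Function.update_self, smul_eq_mul, smul_eq_mul, Finset.mul_sum,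
        add_comm, mul_comm]
      congr 1
      · refine congrArg _ (Finset.prod_congr rfl fun i hi => ?_)
        rw [Function.update_of_ne (ne_of_mem_of_not_mem hi ha)]
      · refine Finset.sum_congr rfl fun k hk => ?_
        rw [Finset.prod_insert ha, Function.update_of_ne (ne_of_mem_of_not_mem hk ha).symm]
  simp only [Matrix.det_apply, map_sum, Units.smul_def, map_zsmul, hprod]
  rw [Finset.sum_comm]
  refine Finset.sum_congr rfl fun σ _ => ?_
  rw [Finset.smul_sum]
  refine Finset.sum_congr rfl fun k _ => ?_
  refine congrArg _ (Finset.prod_congr rfl fun i _ => ?_)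
  rw [Matrix.updateCol_apply, Function.update_apply]
  split_ifs with h <;> simp [h]

lemma Derivation.map_det_eq_zero {R A ι : Type*} [CommRing R] [CommRing A] [Algebra R A]
    [Fintype ι] [DecidableEq ι] (D : Derivation R A A) (M : Matrix ι ι A)
    (h : ∀ k, (∀ i, D (M i k) = 0) ∨ ∃ k', k' ≠ k ∧ ∀ i, D (M i k) = M i k') :
    D M.det = 0 := by
  rw [Derivation.map_det]
  refine Finset.sum_eq_zero fun k _ => ?_
  rcases h k with h | ⟨k', hk', h⟩
  · exact Matrix.det_eq_zero_of_column_eq_zero k fun i => by simp [h]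
  · exact Matrix.det_zero_of_column_eq hk' fun i => by simp [h, hk']

/-- The weight counting the variables whose index on the axis `s` is `i`. -/
def axisWeight (s : Fin 3) (i : ℕ) (v : Fin 3 → ℕ) : ℕ := if v s = i then 1 else 0

lemma isWeightedHomogeneous_derivation {σ : Type*} {w : σ → ℕ} {δ n : ℕ}
    {D : Derivation ℂ (MvPolynomial σ ℂ) (MvPolynomial σ ℂ)}
    (hD : ∀ v, IsWeightedHomogeneous w (D (X v)) (w v + δ)) {p : MvPolynomial σ ℂ}
    (hp : IsWeightedHomogeneous w p n) : IsWeightedHomogeneous w (D p) (n + δ) := by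
  have hDe : D = mkDerivation ℂ fun v => D (X v) := derivation_ext fun v => by
    rw [mkDerivation_X]
  rw [p.as_sum, map_sum]
  refine IsWeightedHomogeneous.sum _ _ _ fun m hm => ?_
  rw [hDe, mkDerivation_monomial, ← mem_weightedHomogeneousSubmodule]
  refine Submodule.smul_mem _ _ (Submodule.sum_mem _ fun v hv => ?_)
  rw [mem_weightedHomogeneousSubmodule]
  beta_reduce
  rw [smul_eq_mul]
  have hv' : Finsupp.single v 1 ≤ m := by
    rw [Finsupp.single_le_iff, Nat.one_le_iff_ne_zero]
    exact Finsupp.mem_support_iff.1 hv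
  have hw := hp (mem_support_iff.1 hm)
  obtain ⟨m', rfl⟩ := exists_add_of_le hv'
  rw [map_add, Finsupp.weight_single, one_smul] at hw
  rw [add_tsub_cancel_left, ← hw, show w v + Finsupp.weight w m' + δ =
    Finsupp.weight w m' + (w v + δ) by ring]
  exact (isWeightedHomogeneous_monomial _ _ _ rfl).mul (hD v)

lemma isWeightedHomogeneous_det {σ ι : Type*} [Fintype ι] [DecidableEq ι] {w : σ → ℕ}
    {M : Matrix ι ι (MvPolynomial σ ℂ)} {A B : ι → ℕ}
    (h : ∀ i j, IsWeightedHomogeneous w (M i j) (A i + B j)) :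
    IsWeightedHomogeneous w M.det (∑ i, A i + ∑ i, B i) := by
  rw [Matrix.det_apply]
  refine IsWeightedHomogeneous.sum _ _ _ fun σ _ => ?_
  rw [← mem_weightedHomogeneousSubmodule, Units.smul_def]
  refine zsmul_mem ?_ _
  rw [mem_weightedHomogeneousSubmodule]
  have := IsWeightedHomogeneous.prod Finset.univ (fun i => M (σ i) i) (fun i => A (σ i) + B i)
    fun i _ => h _ _
  rwa [Finset.sum_add_distrib, Equiv.sum_comp σ A] at this

/-- The leading principal minor of size `q` of the generic matrix `x_{ab0}`. -/
noncomputable def sliceMinor (q : ℕ) : MvPolynomial (Fin 3 → ℕ) ℂ :=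
  (Matrix.of fun a b : Fin q => X ![(a : ℕ), b, 0]).det

lemma sliceMinor_mem_supported (q : ℕ) :
    sliceMinor q ∈ supported ℂ {v : Fin 3 → ℕ | v 2 = 0} := by
  rw [sliceMinor, Matrix.det_apply]
  refine Subalgebra.sum_mem _ fun σ _ => ?_
  rw [Units.smul_def]
  refine zsmul_mem (Subalgebra.prod_mem _ fun i _ => ?_) _
  rw [Matrix.of_apply, X_mem_supported]
  rfl

lemma polarization_sliceMinor (q : ℕ) {s : Fin 3} {i j : ℕ} (h : i < j) :
    polarization s i j (sliceMinor q) = 0 := by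
  fin_cases s
  · rw [sliceMinor, ← Matrix.det_transpose]
    refine Derivation.map_det_eq_zero _ _ fun k => ?_
    by_cases hk : (k : ℕ) = j
    · refine Or.inr ⟨⟨i, by omega⟩, by simp [Fin.ext_iff]; omega, fun b => ?_⟩
      simp only [Matrix.transpose_apply, Matrix.of_apply, polarization_X, hk]
      rw [if_pos (by rfl)]
      exact congrArg X (by ext t; fin_cases t <;> rfl)
    · exact Or.inl fun b => by simp [polarization_X, hk]
  · refine Derivation.map_det_eq_zero _ _ fun k => ?_
    by_cases hk : (k : ℕ) = j
    · refine Or.inr ⟨⟨i, by omega⟩, by simp [Fin.ext_iff]; omega, fun b => ?_⟩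
      simp only [Matrix.of_apply, polarization_X, hk]
      rw [if_pos (by rfl)]
      exact congrArg X (by ext t; fin_cases t <;> rfl)
    · exact Or.inl fun b => by simp [polarization_X, hk]
  · refine (derivation_eqOn_supported (D₂ := 0) (fun v hv => ?_) (sliceMinor_mem_supported q))
    have hv : v 2 = 0 := hv
    simp [polarization_X, hv, show 0 ≠ j by omega]

lemma sliceMinor_weight {q : ℕ} {s : Fin 3} (hs : s ≠ 2) (i : ℕ) :
    IsWeightedHomogeneous (axisWeight s i) (sliceMinor q) (if i < q then 1 else 0) := by
  have hc : ∑ a : Fin q, (if (a : ℕ) = i then 1 else 0) = if i < q then 1 else 0 := by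
    rw [Finset.sum_boole]
    split_ifs with h
    · rw [Nat.cast_id, Finset.card_eq_one]
      exact ⟨⟨i, h⟩, by ext; simp [Fin.ext_iff]⟩
    · rw [Nat.cast_id, Finset.card_eq_zero, Finset.filter_eq_empty_iff]
      intro x _
      omega
  rw [← hc]
  obtain rfl | rfl : s = 0 ∨ s = 1 := by omega
  · have := isWeightedHomogeneous_det (w := axisWeight 0 i)
      (M := Matrix.of fun a b : Fin q => X ![(a : ℕ), b, 0])
      (A := fun a => if (a : ℕ) = i then 1 else 0) (B := 0)
      fun a b => isWeightedHomogeneous_X ℂ (axisWeight 0 i) ![(a : ℕ), b, 0]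
    rwa [Fintype.sum_eq_zero (0 : Fin q → ℕ) fun _ => rfl, add_zero] at this
  · have := isWeightedHomogeneous_det (w := axisWeight 1 i)
      (M := Matrix.of fun a b : Fin q => X ![(a : ℕ), b, 0])
      (A := 0) (B := fun a => if (a : ℕ) = i then 1 else 0)
      fun a b => by
        rw [Pi.zero_apply, zero_add]
        exact isWeightedHomogeneous_X ℂ (axisWeight 1 i) ![(a : ℕ), b, 0]
    rwa [Fintype.sum_eq_zero (0 : Fin q → ℕ) fun _ => rfl, zero_add] at this

lemma sliceMinor_weight_slice (q : ℕ) {i : ℕ} (hi : i ≠ 0) :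
    IsWeightedHomogeneous (axisWeight 2 i) (sliceMinor q) 0 := by
  have := isWeightedHomogeneous_det (w := axisWeight 2 i)
    (M := Matrix.of fun a b : Fin q => X ![(a : ℕ), b, 0]) (A := 0) (B := 0)
    fun a b => by
      have := isWeightedHomogeneous_X ℂ (axisWeight 2 i) ![(a : ℕ), b, 0]
      rwa [axisWeight, if_neg (show ¬ ![(a : ℕ), b, 0] 2 = i from hi.symm)] at this
  rwa [Fintype.sum_eq_zero (0 : Fin q → ℕ) fun _ => rfl, zero_add] at this

/-- The numbering of the index set of the polarized determinant. -/
def blockEquiv (s d : ℕ) : (Fin s × Fin s) ⊕ Fin d ≃ Fin (s * s + d) :=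
  (Equiv.sumCongr finProdFinEquiv (Equiv.refl _)).trans finSumFinEquiv

/-- The polynomials of which the Jacobian determinant is taken: the entries of the leading
`s × s` block, followed by the leading minors of sizes `s + 1, …, s + d`. -/
noncomputable def blockPolynomial (s d : ℕ) :
    (Fin s × Fin s) ⊕ Fin d → MvPolynomial (Fin 3 → ℕ) ℂ :=
  Sum.elim (fun x => X ![(x.1 : ℕ), x.2, 0]) fun t => sliceMinor (s + 1 + t)

/-- The determinant of the polarizations of the block polynomials to the first `s * s + d`
slices. -/
noncomputable def blockJacobian (s d : ℕ) : MvPolynomial (Fin 3 → ℕ) ℂ :=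
  (Matrix.of fun κ κ' => polarization 2 (blockEquiv s d κ) 0 (blockPolynomial s d κ')).det

lemma blockPolynomial_mem_supported (s d : ℕ) (κ : (Fin s × Fin s) ⊕ Fin d) :
    blockPolynomial s d κ ∈ supported ℂ {v : Fin 3 → ℕ | v 2 = 0} := by
  rcases κ with x | t
  · exact (X_mem_supported ..).2 rfl
  · exact sliceMinor_mem_supported _

lemma update_vec_zero (a b c i : ℕ) : Function.update ![a, b, c] 0 i = ![i, b, c] := by
  ext t; fin_cases t <;> rfl

lemma update_vec_one (a b c i : ℕ) : Function.update ![a, b, c] 1 i = ![a, i, c] := by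
  ext t; fin_cases t <;> rfl

lemma update_vec_two (a b c i : ℕ) : Function.update ![a, b, c] 2 i = ![a, b, i] := by
  ext t; fin_cases t <;> rfl

lemma polarization_blockJacobian (s d : ℕ) {r : Fin 3} {i j : ℕ} (h : i < j) :
    polarization r i j (blockJacobian s d) = 0 := by
  by_cases hr : r = 2
  · subst hr
    rw [blockJacobian, ← Matrix.det_transpose]
    refine Derivation.map_det_eq_zero _ _ fun κ => ?_
    simp only [Matrix.transpose_apply, Matrix.of_apply,
      polarization_polarization_of_supported h (blockPolynomial_mem_supported s d _)]
    by_cases hκ : (blockEquiv s d κ : ℕ) = j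
    · refine Or.inr ⟨(blockEquiv s d).symm ⟨i, by omega⟩, ?_, fun κ' => ?_⟩
      · rw [Ne, Equiv.symm_apply_eq, Fin.ext_iff]
        exact (hκ ▸ h).ne
      · simp [hκ]
    · simp [hκ]
  · refine Derivation.map_det_eq_zero _ _ fun κ => ?_
    simp only [Matrix.of_apply, polarization_comm hr]
    rcases κ with x | t
    · simp only [blockPolynomial, Sum.elim_inl, polarization_X]
      obtain rfl | rfl : r = 0 ∨ r = 1 := by omega
      · by_cases hx : (x.1 : ℕ) = j
        · refine Or.inr ⟨Sum.inl (⟨i, by omega⟩, x.2), ?_, fun κ' => ?_⟩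
          · simp [Prod.ext_iff, Fin.ext_iff, hx, h.ne]
          · simp [hx, update_vec_zero]
        · exact Or.inl fun κ' => by simp [hx]
      · by_cases hx : (x.2 : ℕ) = j
        · refine Or.inr ⟨Sum.inl (x.1, ⟨i, by omega⟩), ?_, fun κ' => ?_⟩
          · simp [Prod.ext_iff, Fin.ext_iff, hx, h.ne]
          · simp [hx, update_vec_one]
        · exact Or.inl fun κ' => by simp [hx]
    · exact Or.inl fun κ' => by simp [blockPolynomial, polarization_sliceMinor _ h]

lemma polarization_two_weight {r : Fin 3} (hr : r ≠ 2) (i l : ℕ) {n : ℕ}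
    {p : MvPolynomial (Fin 3 → ℕ) ℂ} (hp : IsWeightedHomogeneous (axisWeight r i) p n) :
    IsWeightedHomogeneous (axisWeight r i) (polarization 2 l 0 p) n := by
  refine isWeightedHomogeneous_derivation (δ := 0) (fun v => ?_) hp
  rw [polarization_X]
  split_ifs with hv
  · have := isWeightedHomogeneous_X ℂ (axisWeight r i) (Function.update v 2 l)
    rwa [axisWeight, Function.update_of_ne hr] at this
  · exact isWeightedHomogeneous_zero _ _ _

lemma polarization_two_weight_slice {i : ℕ} (hi : i ≠ 0) (l : ℕ) {n : ℕ}
    {p : MvPolynomial (Fin 3 → ℕ) ℂ} (hp : IsWeightedHomogeneous (axisWeight 2 i) p n) :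
    IsWeightedHomogeneous (axisWeight 2 i) (polarization 2 l 0 p) (n + if l = i then 1 else 0) := by
  refine isWeightedHomogeneous_derivation (fun v => ?_) hp
  rw [polarization_X]
  split_ifs with hv
  all_goals try exact isWeightedHomogeneous_zero _ _ _
  all_goals
    have := isWeightedHomogeneous_X ℂ (axisWeight 2 i) (Function.update v 2 l)
    rw [axisWeight, Function.update_self] at this
    rw [axisWeight, if_neg (hv.trans_ne hi.symm)]
    simp_all

lemma blockJacobian_weight (s d : ℕ) {r : Fin 3} (hr : r ≠ 2) (i : ℕ) :
    IsWeightedHomogeneous (axisWeight r i) (blockJacobian s d)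
      ((if i < s then s else 0) + ∑ t : Fin d, if i < s + 1 + t then 1 else 0) := by
  have hc : ∑ a : Fin s, (if (a : ℕ) = i then 1 else 0) = if i < s then 1 else 0 := by
    rw [Finset.sum_boole]
    split_ifs with h
    · rw [Nat.cast_id, Finset.card_eq_one]
      exact ⟨⟨i, h⟩, by ext; simp [Fin.ext_iff]⟩
    · rw [Nat.cast_id, Finset.card_eq_zero, Finset.filter_eq_empty_iff]
      intro x _
      omega
  let B : (Fin s × Fin s) ⊕ Fin d → ℕ := Sum.elim
    (fun x => axisWeight r i ![(x.1 : ℕ), x.2, 0]) fun t => if i < s + 1 + t then 1 else 0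
  have h := isWeightedHomogeneous_det (w := axisWeight r i) (M := Matrix.of fun κ κ' =>
    polarization 2 (blockEquiv s d κ) 0 (blockPolynomial s d κ')) (A := 0) (B := B)
    fun κ κ' => by
      rw [Pi.zero_apply, zero_add]
      refine polarization_two_weight hr i _ ?_
      rcases κ' with x | t
      · exact isWeightedHomogeneous_X ..
      · exact sliceMinor_weight hr i
  rw [Fintype.sum_eq_zero (0 : (Fin s × Fin s) ⊕ Fin d → ℕ) fun _ => rfl, zero_add] at h
  rw [blockJacobian]
  convert h using 1
  rw [Fintype.sum_sum_type]
  refine congrArg (· + _) ?_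
  simp only [B, Sum.elim_inl, axisWeight]
  have hm : (if i < s then s else 0) =
      ∑ _y : Fin s, ∑ a : Fin s, if (a : ℕ) = i then 1 else 0 := by
    rw [hc, Finset.sum_const, Finset.card_univ, Fintype.card_fin, smul_eq_mul, mul_ite, mul_one,
      mul_zero]
  obtain rfl | rfl : r = 0 ∨ r = 1 := by omega
  · rw [Fintype.sum_prod_type_right]
    exact hm
  · rw [Fintype.sum_prod_type]
    exact hm

lemma blockJacobian_weight_slice (s d : ℕ) {i : ℕ} (hi : i ≠ 0) :
    IsWeightedHomogeneous (axisWeight 2 i) (blockJacobian s d)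
      (if i < s * s + d then 1 else 0) := by
  have h := isWeightedHomogeneous_det (w := axisWeight 2 i) (M := Matrix.of fun κ κ' =>
    polarization 2 (blockEquiv s d κ) 0 (blockPolynomial s d κ'))
    (A := fun κ => if (blockEquiv s d κ : ℕ) = i then 1 else 0) (B := 0)
    fun κ κ' => by
      rw [Pi.zero_apply, add_comm _ 0]
      refine polarization_two_weight_slice hi _ ?_
      rcases κ' with x | t
      · have := isWeightedHomogeneous_X ℂ (axisWeight 2 i) ![(x.1 : ℕ), x.2, 0]
        rwa [axisWeight, if_neg (show ¬ ![(x.1 : ℕ), x.2, 0] 2 = i from hi.symm)] at this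
      · exact sliceMinor_weight_slice _ hi
  rw [Fintype.sum_eq_zero (0 : (Fin s × Fin s) ⊕ Fin d → ℕ) fun _ => rfl, add_zero] at h
  rw [blockJacobian]
  convert h using 1
  rw [Equiv.sum_comp (blockEquiv s d) fun a : Fin (s * s + d) => if (a : ℕ) = i then 1 else 0,
    Finset.sum_boole]
  split_ifs with h
  · rw [Nat.cast_id, eq_comm, Finset.card_eq_one]
    exact ⟨⟨i, h⟩, by ext; simp [Fin.ext_iff]⟩
  · rw [Nat.cast_id, eq_comm, Finset.card_eq_zero, Finset.filter_eq_empty_iff]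
    intro x _
    omega

lemma eval_sliceMinor {f : (Fin 3 → ℕ) → ℂ} (hf : ∀ a b, f ![a, b, 0] = if a = b then 1 else 0)
    (q : ℕ) : eval f (sliceMinor q) = 1 := by
  rw [sliceMinor, RingHom.map_det, ← Matrix.det_one (n := Fin q)]
  congr 1
  ext a b
  simp [hf, Matrix.one_apply, Fin.ext_iff]

lemma eval_polarization_sliceMinor {f : (Fin 3 → ℕ) → ℂ}
    (hf : ∀ a b, f ![a, b, 0] = if a = b then 1 else 0) (q l : ℕ) :
    eval f (polarization 2 l 0 (sliceMinor q)) = ∑ k ∈ Finset.range q, f ![k, k, l] := by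
  rw [sliceMinor, Derivation.map_det, map_sum, Finset.sum_range]
  refine Finset.sum_congr rfl fun k _ => ?_
  rw [RingHom.map_det]
  have : (eval f).mapMatrix ((Matrix.of fun a b : Fin q => X ![(a : ℕ), b, 0]).updateCol k fun i =>
      polarization 2 l 0 (Matrix.of (fun a b : Fin q => X ![(a : ℕ), b, 0]) i k)) =
      (1 : Matrix (Fin q) (Fin q) ℂ).updateCol k fun a => f ![a, k, l] := by
    ext a b
    simp only [RingHom.mapMatrix_apply, Matrix.map_apply, Matrix.updateCol_apply, Matrix.of_apply,
      polarization_X]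
    split_ifs
    · simp [update_vec_two]
    · simp_all
    · simp [hf, Matrix.one_apply, Fin.ext_iff]
  rw [this, ← Matrix.cramer_apply, Matrix.cramer_one]
  rfl

lemma sliceMinor_ne_zero (q : ℕ) : sliceMinor q ≠ 0 := by
  intro h
  have := eval_sliceMinor (f := fun v => if v 0 = v 1 then 1 else 0) (fun _ _ => rfl) q
  simp [h] at this

lemma blockJacobian_ne_zero {s : ℕ} (hs : s ≠ 0) (d : ℕ) : blockJacobian s d ≠ 0 := by
  have hpos : 0 < s := Nat.pos_of_ne_zero hs
  let e := blockEquiv s d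
  let B : (Fin s × Fin s) ⊕ Fin d → ℕ → ℕ → ℂ := Sum.elim
    (fun x a b => if a = x.1 ∧ b = x.2 then 1 else 0)
    fun t a b => if a = b then
      (if a = s + t then 1 else 0) - (if a = s + t + 1 then 1 else 0) else 0
  let f : (Fin 3 → ℕ) → ℂ := fun v => if v 2 = 0 then (if v 0 = v 1 then 1 else 0) else
    if h : v 2 < s * s + d then B (e.symm ⟨v 2, h⟩) (v 0) (v 1) else 0
  have hf : ∀ a b, f ![a, b, 0] = if a = b then 1 else 0 := fun a b => rfl
  have he : ∀ κ : (Fin s × Fin s) ⊕ Fin d, (e κ : ℕ) = 0 ↔ κ = Sum.inl (⟨0, hpos⟩, ⟨0, hpos⟩) := by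
    intro κ
    have h0 : (e (Sum.inl (⟨0, hpos⟩, ⟨0, hpos⟩)) : ℕ) = 0 := by
      simp [e, blockEquiv]
    rw [← e.injective.eq_iff, Fin.ext_iff, h0]
  have hfB : ∀ κ a b, (e κ : ℕ) ≠ 0 → f ![a, b, e κ] = B κ a b := by
    intro κ a b h
    have : f ![a, b, e κ] = if (e κ : ℕ) = 0 then (if a = b then 1 else 0) else
      if h : (e κ : ℕ) < s * s + d then B (e.symm ⟨e κ, h⟩) a b else 0 := rfl
    rw [this, if_neg h, dif_pos (e κ).2]
    simp
  intro h
  have hdet : (Matrix.of fun κ κ' =>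
      eval f (polarization 2 (e κ) 0 (blockPolynomial s d κ'))).det = 0 := by
    have := congrArg (eval f) h
    rwa [blockJacobian, RingHom.map_det, map_zero] at this
  obtain ⟨v, hv, hker⟩ := Matrix.exists_mulVec_eq_zero_iff.2 hdet
  have hrow : ∀ κ, ∑ x : Fin s × Fin s, f ![(x.1 : ℕ), x.2, e κ] * v (Sum.inl x) +
      ∑ t : Fin d, (∑ k ∈ Finset.range (s + 1 + t), f ![k, k, e κ]) * v (Sum.inr t) = 0 := by
    intro κ
    have := congrFun hker κ
    rw [Matrix.mulVec, dotProduct, Fintype.sum_sum_type] at this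
    simpa [blockPolynomial, polarization_X, update_vec_two, eval_polarization_sliceMinor hf]
      using this
  have hr : ∀ t, v (Sum.inr t) = 0 := by
    intro t
    have h := hrow (Sum.inr t)
    have hne : (e (Sum.inr t) : ℕ) ≠ 0 := by simp [he]
    simp only [hfB _ _ _ hne, B, Sum.elim_inr] at h
    rw [Finset.sum_eq_zero, zero_add, Finset.sum_eq_single t] at h
    · simpa [Finset.sum_sub_distrib, show ¬ s + (t : ℕ) + 1 < s + 1 + t by omega] using h
    · intro t' _ ht
      rw [mul_eq_zero]
      left
      have : (t' : ℕ) ≠ t := fun h => ht (Fin.ext h)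
      simp only [if_true, Finset.sum_sub_distrib, Finset.sum_ite_eq', Finset.mem_range]
      split_ifs <;> first | omega | simp
    · simp
    · intro x _
      have := x.1.2
      rw [if_neg (c := (x.1 : ℕ) = s + t) (by omega),
        if_neg (c := (x.1 : ℕ) = s + t + 1) (by omega)]
      simp
  simp only [hr, mul_zero, Finset.sum_const_zero, add_zero] at hrow
  have hl : ∀ x, x ≠ (⟨0, hpos⟩, ⟨0, hpos⟩) → v (Sum.inl x) = 0 := by
    intro x hx
    have h := hrow (Sum.inl x)
    have hne : (e (Sum.inl x) : ℕ) ≠ 0 := by simp [he, hx]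
    simp only [hfB _ _ _ hne, B, Sum.elim_inl] at h
    rw [Finset.sum_eq_single x] at h
    · simpa using h
    · intro y _ hy
      rw [if_neg, zero_mul]
      rintro ⟨h1, h2⟩
      exact hy (Prod.ext (Fin.ext h1) (Fin.ext h2))
    · simp
  have h0 : v (Sum.inl (⟨0, hpos⟩, ⟨0, hpos⟩)) = 0 := by
    have h := hrow (Sum.inl (⟨0, hpos⟩, ⟨0, hpos⟩))
    rw [(he _).2 rfl, Finset.sum_eq_single (⟨0, hpos⟩, ⟨0, hpos⟩)] at h
    · simpa [hf] using h
    · intro y _ hy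
      rw [hl y hy, mul_zero]
    · simp
  refine hv (funext ?_)
  rintro (x | t)
  · by_cases hx : x = (⟨0, hpos⟩, ⟨0, hpos⟩)
    · rw [hx, h0]; rfl
    · exact hl x hx
  · exact hr t

lemma weight_wordMonomial {n : ℕ} (z : Fin n → Fin 3 → ℕ) (s : Fin 3) (i : ℕ) :
    Finsupp.weight (axisWeight s i) (wordMonomial z) =
      (Finset.univ.filter fun t => z t s = i).card := by
  simp [wordMonomial, Finsupp.weight_single, axisWeight]

lemma card_axis_eq {n : ℕ} {p : MvPolynomial (Fin 3 → ℕ) ℂ} {z : Fin n → Fin 3 → ℕ}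
    (hz : wordCoeff p z ≠ 0) {s : Fin 3} {i d : ℕ}
    (hp : IsWeightedHomogeneous (axisWeight s i) p d) :
    (Finset.univ.filter fun t => z t s = i).card = d := by
  rw [← weight_wordMonomial]
  exact hp (right_ne_zero_of_mul hz)

lemma sum_wordContent {n A : ℕ} (w : Fin n → Fin A) : ∑ i, wordContent w i = n := by
  have := Finset.card_eq_sum_card_fiberwise (f := w) (s := Finset.univ) (t := Finset.univ) (by simp)
  rw [Finset.card_univ, Fintype.card_fin] at this
  exact this.symm

lemma wordCoeff_mem_highestWeight {n A : ℕ} {p : MvPolynomial (Fin 3 → ℕ) ℂ} {s : Fin 3}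
    {lam : ℕ → ℕ} (b : Fin n → Fin 3 → ℕ) (hp : ∀ i j, i < j → polarization s i j p = 0)
    (hw : ∀ i ≠ 0, IsWeightedHomogeneous (axisWeight s i) p (lam i))
    (hsum : ∑ i : Fin A, lam i = n) :
    (fun w : Fin n → Fin A => wordCoeff p fun t => Function.update (b t) s (w t)) ∈
      (highestWeight n fun i : Fin A => lam i).toSubmodule := by
  refine ⟨fun w hne => ?_, fun i j hij => funext fun w => ?_⟩
  · by_contra h
    have hi : ∀ i : Fin A, (i : ℕ) ≠ 0 → wordContent w i = lam i := fun i hi => by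
      rw [← card_axis_eq h (hw i hi), wordContent]
      simp [Fin.ext_iff]
    refine hne (funext fun i => ?_)
    by_cases h0 : (i : ℕ) = 0
    · have h1 : ∑ i : Fin A, wordContent w i = ∑ i : Fin A, lam i := by
        rw [hsum, sum_wordContent]
      rw [← Finset.add_sum_erase _ _ (Finset.mem_univ i),
        ← Finset.add_sum_erase _ (fun i : Fin A => lam i) (Finset.mem_univ i),
        Finset.sum_congr rfl fun j hj => hi j fun hj0 =>
          Finset.ne_of_mem_erase hj (Fin.ext (hj0.trans h0.symm))] at h1
      exact add_right_cancel h1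
    · exact hi i h0
  · rw [raising_apply, Pi.zero_apply]
    have h := sum_wordCoeff_update_eq_zero (hp i j hij) fun t => Function.update (b t) s (w t)
    simp only [Function.update_self, Function.update_idem] at h
    rw [← h]
    refine Finset.sum_congr (by simp [Fin.ext_iff]) fun t _ => congrArg _ (funext fun r => ?_)
    rcases eq_or_ne r t with rfl | hr
    · simp
    · simp [hr]

/-- A nonzero polynomial with the symmetry of a tensor in `S_λ ⊗ S_λ ⊗ S_μ` yields a nonzero
morphism `S_μ ⟶ S_λ ⊗ S_λ`. -/
lemma exists_hom_of_polynomial {n a k : ℕ} {lam mu : ℕ → ℕ} {p : MvPolynomial (Fin 3 → ℕ) ℂ}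
    (hp0 : p ≠ 0) (hp : ∀ s i j, i < j → polarization s i j p = 0)
    (hlam : ∀ s ≠ 2, ∀ i, IsWeightedHomogeneous (axisWeight s i) p (lam i))
    (hmu : ∀ i ≠ 0, IsWeightedHomogeneous (axisWeight 2 i) p (mu i))
    (hlam_sum : ∑ i : Fin a, lam i = n) (hlam_zero : ∀ i, a ≤ i → lam i = 0)
    (hmu_sum : ∑ i : Fin (k + 1), mu i = n) (hmu_zero : ∀ i, k < i → mu i = 0) :
    ∃ T : weightRep n (fun i : Fin (k + 1) => mu i) ⟶
      weightRep n (fun i : Fin a => lam i) ⊗ weightRep n (fun i : Fin a => lam i), T ≠ 0 := by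
  refine exists_hom_tensor (fun u v w => wordCoeff p fun t => ![(u t : ℕ), v t, w t])
    (fun σ u v w => ?_) (fun v w => ?_) (fun u w => ?_) (fun u v => ?_) ?_
  · have := wordMonomial_comp (fun t => ![(u t : ℕ), v t, w t]) σ
    simp only [wordCoeff, ← this]
    rfl
  · have := wordCoeff_mem_highestWeight (fun t => ![0, v t, w t]) (hp 0)
      (fun i _ => hlam 0 (by decide) i) hlam_sum
    simpa only [update_vec_zero] using this
  · have := wordCoeff_mem_highestWeight (fun t => ![u t, 0, w t]) (hp 1)
      (fun i _ => hlam 1 (by decide) i) hlam_sum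
    simpa only [update_vec_one] using this
  · have := wordCoeff_mem_highestWeight (fun t => ![u t, v t, 0]) (hp 2) hmu hmu_sum
    simpa only [update_vec_two] using this
  · obtain ⟨m, hm⟩ := ne_zero_iff.1 hp0
    obtain ⟨N, hN⟩ : ∃ N, m.degree = N := ⟨_, rfl⟩
    obtain ⟨z, rfl⟩ := exists_wordMonomial hN
    have hz : wordCoeff p z ≠ 0 := mul_ne_zero (exponentFactorial_ne_zero _) hm
    have hlt : ∀ s ≠ 2, ∀ t, z t s < a := by
      intro s hs t
      by_contra! hle
      have h := card_axis_eq hz (hlam s hs (z t s))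
      rw [hlam_zero _ hle, Finset.card_eq_zero] at h
      exact Finset.notMem_empty t (h ▸ by simp)
    have hlt' : ∀ t, z t 2 < k + 1 := by
      intro t
      by_contra! hle
      have h := card_axis_eq hz (hmu (z t 2) (by omega))
      rw [hmu_zero _ (by omega), Finset.card_eq_zero] at h
      exact Finset.notMem_empty t (h ▸ by simp)
    have hn : N = n := by
      rw [← hlam_sum]
      conv_lhs => rw [← Fintype.card_fin N, ← Finset.card_univ]
      rw [Finset.card_eq_sum_card_fiberwise
        (f := fun t => (⟨z t 0, hlt 0 (by decide) t⟩ : Fin a)) (t := Finset.univ) (by simp)]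
      refine Finset.sum_congr rfl fun i _ => ?_
      rw [← card_axis_eq hz (hlam 0 (by decide) i)]
      simp [Fin.ext_iff]
    subst hn
    refine ⟨fun t => ⟨z t 0, hlt 0 (by decide) t⟩, fun t => ⟨z t 1, hlt 1 (by decide) t⟩,
      fun t => ⟨z t 2, hlt' t⟩, ?_⟩
    convert hz using 3 with t
    ext r
    fin_cases r <;> rfl

/-- The number of columns of length `q` of the block of columns attached to a slice count `c`:
`√c` columns of length `√c` and one of each length up to `√c + (c - √c ^ 2)`. -/
def blockColumns (c q : ℕ) : ℕ :=
  (if q = c.sqrt then c.sqrt else 0) +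
    ∑ t : Fin (c - c.sqrt * c.sqrt), if q = c.sqrt + 1 + t then 1 else 0

lemma sqrt_add_sub_le (c : ℕ) : c.sqrt + (c - c.sqrt * c.sqrt) ≤ 3 * c.sqrt := by
  have := Nat.sqrt_le_add c
  omega

lemma mul_blockColumns_le (r q : ℕ) : q * blockColumns (r + 2) q ≤ 6 * (r + 1) := by
  rw [blockColumns]
  set s := (r + 2).sqrt
  have h1 : s * s ≤ r + 2 := Nat.sqrt_le _
  have h2 : s + (r + 2 - s * s) ≤ 3 * s := sqrt_add_sub_le _
  by_cases hq : q = s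
  · rw [if_pos hq, Finset.sum_eq_zero fun t _ => if_neg (by omega), add_zero, hq]
    omega
  · rw [if_neg hq, zero_add, Finset.sum_boole, Nat.cast_id]
    by_cases hq' : q ≤ 3 * s
    · have hc : (Finset.univ.filter fun t : Fin (r + 2 - s * s) => q = s + 1 + t).card ≤ 1 :=
        Finset.card_le_one.2 fun x hx y hy => by
          simp only [Finset.mem_filter_univ] at hx hy
          omega
      have : s ≤ s * s := Nat.le_mul_self s
      calc _ ≤ q * 1 := Nat.mul_le_mul_left q hc
        _ ≤ _ := by omega
    · rw [Finset.filter_eq_empty_iff.2 fun t _ => by omega]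
      simp

lemma sum_blockColumns {c a : ℕ} (hc : c ≠ 0) (ha : 3 * c.sqrt ≤ a) (i : ℕ) :
    ∑ q ∈ Finset.range a, blockColumns c (q + 1) * (if i < q + 1 then 1 else 0) =
      (if i < c.sqrt then c.sqrt else 0) +
        ∑ t : Fin (c - c.sqrt * c.sqrt), if i < c.sqrt + 1 + t then 1 else 0 := by
  have hpos : 0 < c.sqrt := Nat.sqrt_pos.2 (Nat.pos_of_ne_zero hc)
  have h2 := sqrt_add_sub_le c
  simp only [blockColumns, add_mul, Finset.sum_add_distrib, Finset.sum_mul]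
  congr 1
  · rw [Finset.sum_eq_single_of_mem (c.sqrt - 1) (Finset.mem_range.2 (by omega))]
    · rw [Nat.sub_add_cancel hpos]
      simp
    · intro q _ hq
      rw [if_neg (by omega), zero_mul]
  · rw [Finset.sum_comm]
    refine Finset.sum_congr rfl fun t _ => ?_
    rw [Finset.sum_eq_single_of_mem (c.sqrt + t) (Finset.mem_range.2 (by omega))]
    · rw [if_pos (by omega), one_mul, add_right_comm]
    · intro q _ hq
      rw [if_neg (by omega), zero_mul]

lemma sum_mul_sub_succ (mu : ℕ → ℕ) (hmu : Antitone mu) (k : ℕ) :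
    ∑ r ∈ Finset.range k, (mu (r + 1) - mu (r + 2)) * (r + 1) + k * mu (k + 1) =
      ∑ r ∈ Finset.range k, mu (r + 1) := by
  induction k with
  | zero => simp
  | succ k ih =>
    rw [Finset.sum_range_succ, Finset.sum_range_succ, ← ih]
    obtain ⟨d, hd⟩ := exists_add_of_le (hmu (Nat.le_succ (k + 1)))
    rw [hd, show k + 1 + 1 = k + 2 from rfl, Nat.add_sub_cancel_left]
    ring

lemma sum_sub_succ_of_lt (mu : ℕ → ℕ) (hmu : Antitone mu) {l : ℕ} (hl : l ≠ 0) (k : ℕ) :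
    ∑ r ∈ Finset.range k, (mu (r + 1) - mu (r + 2)) * (if l < r + 2 then 1 else 0) =
      if l ≤ k then mu l - mu (k + 1) else 0 := by
  induction k with
  | zero => simp [hl]
  | succ k ih =>
    rw [Finset.sum_range_succ, ih]
    have h1 : mu (k + 2) ≤ mu (k + 1) := hmu (by omega)
    rw [show k + 1 + 1 = k + 2 from rfl]
    by_cases hlk : l ≤ k
    · have h2 := hmu (show l ≤ k + 1 by omega)
      rw [if_pos hlk, if_pos (by omega), if_pos (by omega)]
      omega
    · rw [if_neg hlk, zero_add]
      by_cases hlk' : l = k + 1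
      · subst hlk'
        simp
      · rw [if_neg (by omega), if_neg (by omega), mul_zero]

/-- The number of columns of length `q + 1` of a staircase-like diagram of size `n` with at most
`b + 1` rows having about `6 * k / (q + 1)` columns of each length `q + 1 ≥ 2`. -/
def stairColumns (n k b q : ℕ) : ℕ :=
  if q = 0 then n - ∑ r ∈ Finset.range b, (r + 2) * (6 * k / (r + 2)) else 6 * k / (q + 1)

/-- The length of the row `i` of the staircase-like diagram. -/
def stairShape (n k b i : ℕ) : ℕ :=
  ∑ q ∈ Finset.range (b + 1), stairColumns n k b q * (if i < q + 1 then 1 else 0)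

lemma sum_mul_div_le (k b : ℕ) :
    ∑ r ∈ Finset.range b, (r + 2) * (6 * k / (r + 2)) ≤ 6 * k * b := by
  refine (Finset.sum_le_card_nsmul _ _ (6 * k) fun r _ => Nat.mul_div_le _ _).trans ?_
  rw [Finset.card_range, smul_eq_mul, mul_comm]

lemma sum_stairShape {n k b : ℕ} (h : 6 * k * (b + 1) ≤ n) :
    ∑ i : Fin (b + 1), stairShape n k b i = n := by
  have hle := sum_mul_div_le k b
  simp only [stairShape]
  rw [Finset.sum_comm]
  have : ∀ q ∈ Finset.range (b + 1), ∑ i : Fin (b + 1),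
      stairColumns n k b q * (if (i : ℕ) < q + 1 then 1 else 0) =
      (q + 1) * stairColumns n k b q := by
    intro q hq
    rw [← Finset.mul_sum, mul_comm, Finset.sum_boole, Nat.cast_id, Fin.card_filter_val_lt]
    rw [Finset.mem_range] at hq
    rw [min_eq_right (by omega)]
  rw [Finset.sum_congr rfl this, Finset.sum_range_succ', stairColumns, if_pos rfl]
  have h2 : ∀ q ∈ Finset.range b, (q + 1 + 1) * stairColumns n k b (q + 1) =
      (q + 2) * (6 * k / (q + 2)) := fun q _ => by
    rw [stairColumns, if_neg (by omega)]
  rw [Finset.sum_congr rfl h2]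
  rw [mul_add] at h
  omega

lemma stairShape_eq_zero {n k b i : ℕ} (hi : b + 1 ≤ i) : stairShape n k b i = 0 :=
  Finset.sum_eq_zero fun q hq => by
    rw [Finset.mem_range] at hq
    rw [if_neg (by omega), mul_zero]

lemma le_stairColumns {n k b q x : ℕ} (h : 6 * k * (b + 1) ≤ n) (hx : (q + 1) * x ≤ 6 * k) :
    x ≤ stairColumns n k b q := by
  have hle := sum_mul_div_le k b
  rw [stairColumns]
  split_ifs with hq
  · subst hq
    rw [mul_add] at h
    omega
  · rwa [Nat.le_div_iff_mul_le (by omega), mul_comm]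

lemma Derivation.map_prod_pow_eq_zero {R A ι : Type*} [CommSemiring R] [CommSemiring A]
    [Algebra R A] (D : Derivation R A A) (s : Finset ι) {f : ι → A} (hf : ∀ i ∈ s, D (f i) = 0)
    (e : ι → ℕ) : D (∏ i ∈ s, f i ^ e i) = 0 := by
  refine Finset.prod_induction _ (fun p => D p = 0) (fun p q hp hq => ?_) D.map_one_eq_zero
    fun i hi => ?_
  · rw [Derivation.leibniz, hp, hq, smul_zero, smul_zero, add_zero]
  · rw [Derivation.leibniz_pow, hf i hi, smul_zero, smul_zero]

/-- For every diagram with few boxes below the first row there is a nonzero polynomial with the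
symmetry of a tensor in `S_λ ⊗ S_λ ⊗ S_μ`, where `λ` is the staircase-like diagram. -/
lemma exists_polynomial {n k b : ℕ} {mu : ℕ → ℕ} (hmu : Antitone mu) (hk : mu (k + 1) = 0)
    (hsum : ∑ r ∈ Finset.range k, mu (r + 1) ≤ k) (hb : 3 * (k + 1).sqrt ≤ b + 1)
    (hn : 6 * k * (b + 1) ≤ n) :
    ∃ p : MvPolynomial (Fin 3 → ℕ) ℂ, p ≠ 0 ∧
      (∀ s i j, i < j → polarization s i j p = 0) ∧
      (∀ s ≠ 2, ∀ i, IsWeightedHomogeneous (axisWeight s i) p (stairShape n k b i)) ∧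
      ∀ i ≠ 0, IsWeightedHomogeneous (axisWeight 2 i) p (mu i) := by
  let m : ℕ → ℕ := fun r => mu (r + 1) - mu (r + 2)
  let J : ℕ → MvPolynomial (Fin 3 → ℕ) ℂ := fun r =>
    blockJacobian (r + 2).sqrt (r + 2 - (r + 2).sqrt * (r + 2).sqrt)
  let need : ℕ → ℕ := fun q => ∑ r ∈ Finset.range k, m r * blockColumns (r + 2) (q + 1)
  let e : ℕ → ℕ := fun q => stairColumns n k b q - need q
  have hneed : ∀ q, need q ≤ stairColumns n k b q := by
    intro q
    refine le_stairColumns hn ?_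
    have h := sum_mul_sub_succ mu hmu k
    rw [hk, mul_zero, add_zero] at h
    calc (q + 1) * need q
        = ∑ r ∈ Finset.range k, m r * ((q + 1) * blockColumns (r + 2) (q + 1)) := by
          rw [Finset.mul_sum]
          exact Finset.sum_congr rfl fun r _ => by ring
      _ ≤ ∑ r ∈ Finset.range k, m r * (6 * (r + 1)) :=
          Finset.sum_le_sum fun r _ => Nat.mul_le_mul_left _ (mul_blockColumns_le r _)
      _ = 6 * ∑ r ∈ Finset.range k, m r * (r + 1) := by
          rw [Finset.mul_sum]
          exact Finset.sum_congr rfl fun r _ => by ring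
      _ ≤ 6 * k := by rw [h]; omega
  refine ⟨(∏ r ∈ Finset.range k, J r ^ m r) * ∏ q ∈ Finset.range (b + 1), sliceMinor (q + 1) ^ e q,
    ?_, fun s i j hij => ?_, fun s hs i => ?_, fun i hi => ?_⟩
  · refine mul_ne_zero (Finset.prod_ne_zero_iff.2 fun r _ => pow_ne_zero _ ?_)
      (Finset.prod_ne_zero_iff.2 fun q _ => pow_ne_zero _ (sliceMinor_ne_zero _))
    exact blockJacobian_ne_zero (Nat.sqrt_pos.2 (by omega)).ne' _
  · rw [Derivation.leibniz,
      Derivation.map_prod_pow_eq_zero _ _ fun r _ => polarization_blockJacobian _ _ hij,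
      Derivation.map_prod_pow_eq_zero _ _ fun q _ => polarization_sliceMinor _ hij,
      smul_zero, smul_zero, add_zero]
  · have h1 := (IsWeightedHomogeneous.prod (Finset.range k) (fun r => J r ^ m r) _ fun r _ =>
      (blockJacobian_weight _ _ hs i).pow _).mul
      (IsWeightedHomogeneous.prod (Finset.range (b + 1)) (fun q => sliceMinor (q + 1) ^ e q) _
        fun q _ => (sliceMinor_weight hs i).pow _)
    convert h1 using 1
    have h2 : ∀ r ∈ Finset.range k, (if i < (r + 2).sqrt then (r + 2).sqrt else 0) +
        (∑ t : Fin (r + 2 - (r + 2).sqrt * (r + 2).sqrt),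
          if i < (r + 2).sqrt + 1 + t then 1 else 0) =
        ∑ q ∈ Finset.range (b + 1), blockColumns (r + 2) (q + 1) *
          (if i < q + 1 then 1 else 0) := by
      intro r hr
      rw [Finset.mem_range] at hr
      have : (r + 2).sqrt ≤ (k + 1).sqrt := Nat.sqrt_le_sqrt (by omega)
      exact (sum_blockColumns (by omega) (by omega) i).symm
    rw [Finset.sum_congr rfl fun r hr => congrArg (m r • ·) (h2 r hr)]
    simp only [smul_eq_mul, Finset.mul_sum]
    rw [Finset.sum_comm, ← Finset.sum_add_distrib, stairShape]
    refine Finset.sum_congr rfl fun q _ => ?_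
    simp only [← mul_assoc, ← Finset.sum_mul, ← add_mul]
    rw [Nat.add_sub_cancel' (hneed q)]
  · have h1 := (IsWeightedHomogeneous.prod (Finset.range k) (fun r => J r ^ m r) _ fun r _ =>
      (blockJacobian_weight_slice _ _ hi).pow _).mul
      (IsWeightedHomogeneous.prod (Finset.range (b + 1)) (fun q => sliceMinor (q + 1) ^ e q) _
        fun q _ => (sliceMinor_weight_slice _ hi).pow _)
    convert h1 using 1
    have h2 := sum_sub_succ_of_lt mu hmu hi k
    rw [hk, Nat.sub_zero] at h2
    simp only [smul_eq_mul, mul_zero, Finset.sum_const_zero, add_zero]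
    have h3 : (if i ≤ k then mu i else 0) = mu i := by
      split_ifs with h
      · rfl
      · exact (Nat.le_zero.1 (hk ▸ hmu (by omega : k + 1 ≤ i))).symm
    rw [← h3, ← h2]
    refine Finset.sum_congr rfl fun r _ => ?_
    rw [Nat.add_sub_cancel' (Nat.sqrt_le _)]

end Polarization

lemma exists_hom_stairShape {n k b : ℕ} {z : Fin n → Fin (k + 1)} (hz : wordSupport z ≤ k)
    (hanti : Antitone (wordContent z)) (hb : 3 * (k + 1).sqrt ≤ b + 1)
    (hn : 6 * k * (b + 1) ≤ n) :
    ∃ T : weightRep n (wordContent z) ⟶ weightRep n (fun i : Fin (b + 1) => stairShape n k b i) ⊗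
      weightRep n (fun i : Fin (b + 1) => stairShape n k b i), T ≠ 0 := by
  let mu : ℕ → ℕ := fun i => if h : i < k + 1 then wordContent z ⟨i, h⟩ else 0
  have hmu : (fun i : Fin (k + 1) => mu i) = wordContent z := funext fun i => dif_pos i.2
  have hzero : ∀ i, k < i → mu i = 0 := fun i hi => dif_neg (by omega)
  have hanti' : Antitone mu := by
    intro i j hij
    simp only [mu]
    split_ifs
    · exact hanti hij
    · omega
    · exact Nat.zero_le _
    · exact le_rfl
  have hsum : ∑ i : Fin (k + 1), mu i = n := by
    rw [Finset.sum_congr rfl fun i _ => congrFun hmu i]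
    exact sum_wordContent z
  have hsupp : ∑ r ∈ Finset.range k, mu (r + 1) = wordSupport z := by
    have h1 : wordContent z 0 + wordSupport z = n := by
      simpa [wordContent, wordSupport] using
        Finset.card_filter_add_card_filter_not (s := (Finset.univ : Finset (Fin n)))
          fun t => z t = 0
    have h2 : mu 0 = wordContent z 0 := congrFun hmu 0
    rw [Fin.sum_univ_eq_sum_range, Finset.sum_range_succ'] at hsum
    omega
  obtain ⟨p, hp0, hp, hlam, hmu'⟩ := exists_polynomial hanti' (hzero _ (Nat.lt_succ_self k))
    (hsupp.trans_le hz) hb hn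
  rw [← hmu]
  exact exists_hom_of_polynomial hp0 hp hlam hmu' (sum_stairShape hn)
    (fun i hi => stairShape_eq_zero hi) hsum hzero

lemma simple_weightRep_of_highestWeight_ne_bot {n A : ℕ} {lam : Fin A → ℕ}
    (h : (highestWeight n lam).toSubmodule ≠ ⊥) : Simple (weightRep n lam) := by
  obtain ⟨f, hf, hf0⟩ := Submodule.exists_mem_ne_zero_of_ne_bot h
  obtain ⟨w, hw⟩ := Function.ne_iff.1 hf0
  have hc : wordContent w = lam := by
    by_contra hc
    exact hw (hf.1 w hc)
  subst hc
  exact simple_weightRep h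

lemma simple_weightRep_stairShape {n k b : ℕ} (hb : 3 * (k + 1).sqrt ≤ b + 1)
    (hn : 6 * k * (b + 1) ≤ n) :
    Simple (weightRep n (fun i : Fin (b + 1) => stairShape n k b i)) := by
  have hanti : Antitone (wordContent fun _ : Fin n => (0 : Fin (k + 1))) := by
    intro i j hij
    rcases eq_or_ne j 0 with rfl | hj
    · rw [Fin.le_zero_iff.1 hij]
    · simp [wordContent, hj.symm]
  obtain ⟨T, hT⟩ := exists_hom_stairShape (z := fun _ => 0) (by simp [wordSupport]) hanti hb hn
  refine simple_weightRep_of_highestWeight_ne_bot (highestWeight_ne_bot_of_hom (g := 𝟙 _) ?_)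
  intro h
  refine hT ?_
  rw [← Category.comp_id T, ← MonoidalCategory.id_whiskerRight, h,
    MonoidalPreadditive.zero_whiskerRight, Limits.comp_zero]

lemma exists_forall_mul_sqrt_le (l : ℝ) (hl : 0 < l) : ∃ N : ℕ, ∀ n : ℕ, N ≤ n →
    6 * ⌊l * Real.sqrt n⌋₊ * (3 * (⌊l * Real.sqrt n⌋₊ + 1).sqrt) ≤ n := by
  set C : ℝ := 324 * l ^ 3 + 324 * l ^ 2 + 1 with hC
  refine ⟨⌈C ^ 2⌉₊, fun n hn => ?_⟩
  set x := Real.sqrt n with hx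
  have hxn : x ^ 2 = n := Real.sq_sqrt (Nat.cast_nonneg n)
  have hC1 : 1 ≤ C := by rw [hC]; nlinarith [pow_pos hl 3, pow_pos hl 2]
  have hxC : C ≤ x := Real.le_sqrt_of_sq_le (Nat.ceil_le.1 hn)
  set k := ⌊l * x⌋₊
  have hk : (k : ℝ) ≤ l * x := Nat.floor_le (by positivity)
  have hy : ((k + 1).sqrt : ℝ) ^ 2 ≤ l * x + 1 := by
    have : ((k + 1).sqrt ^ 2 : ℕ) ≤ k + 1 := Nat.sqrt_le' _
    have : ((k + 1).sqrt : ℝ) ^ 2 ≤ k + 1 := by exact_mod_cast this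
    linarith
  suffices (6 * k * (3 * (k + 1).sqrt) : ℝ) ≤ n by exact_mod_cast this
  set y : ℝ := ((k + 1).sqrt : ℝ)
  have hxy : 18 * l * y ≤ x := by
    refine le_of_sq_le_sq ?_ (by linarith)
    have h1 : (18 * l * y) ^ 2 ≤ 324 * l ^ 2 * (l * x + 1) := by
      nlinarith [mul_le_mul_of_nonneg_left hy (by positivity : 0 ≤ 324 * l ^ 2)]
    have h2 : 324 * l ^ 2 ≤ 324 * l ^ 2 * x := le_mul_of_one_le_right (by positivity) (by linarith)
    nlinarith [mul_le_mul_of_nonneg_right hxC (by linarith : 0 ≤ x)]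
  rw [← hxn]
  have h3 : (0 : ℝ) ≤ y := Nat.cast_nonneg _
  nlinarith [mul_le_mul_of_nonneg_right hk h3,
    mul_le_mul_of_nonneg_left hxy (by linarith : 0 ≤ x)]

/-- For every `ℓ > 0` there is `N` such that for all `n ≥ N` there is an irreducible
complex representation `V` of `S_n` such that every irreducible representation of `S_n`
appearing in `τ_n^{⊗⌊ℓ√n⌋}` also appears in `V ⊗ V`. -/
theorem standard_power_in_square (l : ℝ) (hl : 0 < l) :
    ∃ N : ℕ, ∀ n : ℕ, N ≤ n →
      ∃ V : FDRep ℂ (Equiv.Perm (Fin n)), Simple V ∧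
        ∀ W : FDRep ℂ (Equiv.Perm (Fin n)), Simple W →
          (∃ f : W ⟶ tpow (stdRep n) ⌊l * Real.sqrt n⌋₊, f ≠ 0) →
          ∃ g : W ⟶ V ⊗ V, g ≠ 0 := by
  obtain ⟨N, hN⟩ := exists_forall_mul_sqrt_le l hl
  refine ⟨N, fun n hn => ?_⟩
  have h := hN n hn
  generalize ⌊l * Real.sqrt n⌋₊ = k at h ⊢
  obtain ⟨b, hb⟩ : ∃ b, 3 * (k + 1).sqrt = b + 1 :=
    Nat.exists_eq_add_one.2 (Nat.mul_pos (by decide) (Nat.sqrt_pos.2 k.succ_pos))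
  rw [hb] at h
  refine ⟨_, simple_weightRep_stairShape hb.le h, fun W hW ⟨f, hf⟩ => ?_⟩
  obtain ⟨z, hz, hanti, g, hg⟩ := exists_hom_weightRep f hf
  obtain ⟨T, hT⟩ := exists_hom_stairShape hz hanti hb.le h
  have := simple_weightRep_of_highestWeight_ne_bot (highestWeight_ne_bot_of_hom hg)
  have := isIso_of_hom_simple hg
  exact ⟨g ≫ T, fun h0 => hT ((cancel_epi g).1 (h0.trans Limits.comp_zero.symm))⟩
end

section
/- For all integers n, k with 1 ≤ k ≤ n, the staircase partition ρ_n equals the vertical sum, over j = 0, 1, …, k−1, of the horizontal sums (over i = 0, 1, …, k−1) of the staircases ρ_{⌊(n+i−j)/k⌋}; that is, ρ_n = +_V_{j=0}^{k−1} ( +_H_{i=0}^{k−1} ρ_{⌊(n+i−j)/k⌋} ). -/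
/-- A partition, encoded by its weakly decreasing (0-indexed) sequence of parts,
eventually zero.  Equality of partitions is equality of these part functions,
and the horizontal sum `+_H` is pointwise addition of part functions. -/
def IsPtnFun (f : ℕ → ℕ) : Prop :=
  Antitone f ∧ ∃ N, ∀ i, N ≤ i → f i = 0

/-- The staircase partition `ρ_m = (m, m-1, …, 1)`. -/
def rho (m : ℕ) : ℕ → ℕ := fun i => m - i

/-- The conjugate partition: `(conjFun f) j = #{i : f i ≥ j + 1}` is the length
of the `(j+1)`-st column of the Young diagram of `f`. -/
noncomputable def conjFun (f : ℕ → ℕ) : ℕ → ℕ := fun j => {i | j + 1 ≤ f i}.ncard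

/-- The vertical sum `λ +_V μ = (λ' +_H μ')'`. -/
noncomputable def vsum (f g : ℕ → ℕ) : ℕ → ℕ := conjFun (conjFun f + conjFun g)

theorem IsPtnFun.lt_conjFun_iff {f : ℕ → ℕ} (hf : IsPtnFun f) (i j : ℕ) :
    i < conjFun f j ↔ j < f i := by
  obtain ⟨hanti, N, hN⟩ := hf
  have hex : ∃ m, f m ≤ j := ⟨N, by simp [hN N le_rfl]⟩
  have hmem (i : ℕ) : j < f i ↔ i < Nat.find hex := by
    rw [Nat.lt_find_iff]
    exact ⟨fun h m hm => not_le.2 (h.trans_le (hanti hm)), fun h => not_le.1 (h i le_rfl)⟩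
  have hset : {i | j + 1 ≤ f i} = ↑(Finset.range (Nat.find hex)) := by
    ext i
    simpa [Nat.succ_le_iff] using hmem i
  rw [conjFun, hset, Set.ncard_coe_finset, Finset.card_range, hmem]

theorem IsPtnFun.conjFun {f : ℕ → ℕ} (hf : IsPtnFun f) : IsPtnFun (conjFun f) := by
  refine ⟨fun a b hab => ?_, f 0, fun j hj => ?_⟩
  · refine le_of_forall_lt fun i hi => ?_
    rw [hf.lt_conjFun_iff] at hi ⊢
    exact hab.trans_lt hi
  · by_contra h
    exact absurd ((hf.lt_conjFun_iff 0 j).1 (Nat.pos_of_ne_zero h)) (not_lt.2 hj)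

theorem IsPtnFun.conjFun_conjFun {f : ℕ → ℕ} (hf : IsPtnFun f) :
    _root_.conjFun (_root_.conjFun f) = f := by
  funext i
  refine eq_of_forall_lt_iff fun j => ?_
  rw [hf.conjFun.lt_conjFun_iff, hf.lt_conjFun_iff]

theorem IsPtnFun.zero : IsPtnFun 0 :=
  ⟨fun _ _ _ => le_rfl, 0, fun _ _ => rfl⟩

theorem IsPtnFun.add {f g : ℕ → ℕ} (hf : IsPtnFun f) (hg : IsPtnFun g) : IsPtnFun (f + g) := by
  obtain ⟨hf, M, hM⟩ := hf
  obtain ⟨hg, N, hN⟩ := hg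
  refine ⟨hf.add hg, max M N, fun i hi => ?_⟩
  simp [hM i (le_of_max_le_left hi), hN i (le_of_max_le_right hi)]

theorem conjFun_zero : conjFun 0 = 0 := by
  funext j
  simp [conjFun]

theorem isPtnFun_foldr_vsum_and_conjFun_eq (L : List (ℕ → ℕ)) (hL : ∀ f ∈ L, IsPtnFun f) :
    IsPtnFun (L.foldr vsum 0) ∧ conjFun (L.foldr vsum 0) = (L.map conjFun).sum := by
  induction L with
  | nil => exact ⟨IsPtnFun.zero, conjFun_zero⟩
  | cons f L ih =>
    obtain ⟨hp, hc⟩ := ih fun g hg => hL g (List.mem_cons_of_mem f hg)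
    have hadd := (hL f List.mem_cons_self).conjFun.add hp.conjFun
    refine ⟨hadd.conjFun, ?_⟩
    rw [List.foldr_cons, vsum, hadd.conjFun_conjFun, hc, List.map_cons, List.sum_cons]

/-- Hermite's identity for natural numbers. -/
theorem sum_range_add_div (k : ℕ) (hk : 1 ≤ k) (m : ℕ) :
    ∑ i ∈ Finset.range k, (m + i) / k = m := by
  induction m with
  | zero =>
    refine Finset.sum_eq_zero fun i hi => ?_
    rw [zero_add, Nat.div_eq_of_lt (Finset.mem_range.1 hi)]
  | succ m ih =>
    have h₁ := Finset.sum_range_succ (fun i => (m + i) / k) k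
    have h₂ := Finset.sum_range_succ' (fun i => (m + i) / k) k
    have h₃ : (m + k) / k = m / k + 1 := Nat.add_div_right m hk
    have h₄ : ∑ i ∈ Finset.range k, (m + 1 + i) / k =
        ∑ i ∈ Finset.range k, (m + (i + 1)) / k :=
      Finset.sum_congr rfl fun i _ => by rw [add_assoc, add_comm 1 i]
    simp only [add_zero] at h₂
    omega

theorem isPtnFun_sub_add_mul (n k j : ℕ) (hk : 1 ≤ k) :
    IsPtnFun fun r => n - (j + k * r) := by
  refine ⟨fun a b hab => ?_, n, fun r hr => ?_⟩
  · have := Nat.mul_le_mul_left k hab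
    dsimp only
    omega
  · have := Nat.le_mul_of_pos_left r hk
    dsimp only
    omega

theorem isPtnFun_rho (n : ℕ) : IsPtnFun (rho n) := by
  have h := isPtnFun_sub_add_mul n 1 0 le_rfl
  simp only [zero_add, one_mul] at h
  exact h

theorem conjFun_rho (n c : ℕ) : conjFun (rho n) c = n - c := by
  refine eq_of_forall_lt_iff fun i => ?_
  rw [(isPtnFun_rho n).lt_conjFun_iff, rho]
  omega

theorem sum_rho_div_eq (n k j : ℕ) (hk : 1 ≤ k) :
    ∑ i ∈ Finset.range k, rho ((n + i - j) / k) = fun r => n - (j + k * r) := by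
  funext r
  rw [Finset.sum_apply]
  by_cases h : j + k * r ≤ n
  · rw [← sum_range_add_div k hk (n - (j + k * r))]
    refine Finset.sum_congr rfl fun i _ => ?_
    rw [rho, ← Nat.sub_mul_div]
    congr 1
    omega
  · rw [Nat.sub_eq_zero_of_le (le_of_not_ge h)]
    refine Finset.sum_eq_zero fun i hi => ?_
    have := Finset.mem_range.1 hi
    rw [rho, ← Nat.sub_mul_div]
    exact Nat.div_eq_of_lt (by omega)

theorem conjFun_sub_add_mul (n k j c : ℕ) (hj : j < k) :
    conjFun (fun r => n - (j + k * r)) c = (n - c + (k - 1 - j)) / k := by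
  refine eq_of_forall_lt_iff fun i => ?_
  rw [(isPtnFun_sub_add_mul n k j (by omega)).lt_conjFun_iff, ← Nat.succ_le_iff (m := i),
    Nat.le_div_iff_mul_le (by omega), Nat.succ_mul, mul_comm i k]
  omega

/-- For `1 ≤ k ≤ n`, the staircase `ρ_n` equals the vertical sum over
`j = 0, …, k-1` of the horizontal sums over `i = 0, …, k-1` of the staircases
`ρ_{⌊(n+i-j)/k⌋}`. -/
theorem staircase_grid_decomposition (n k : ℕ) (hk : 1 ≤ k) (hkn : k ≤ n) :
    rho n = ((List.range k).map
      (fun j => ∑ i ∈ Finset.range k, rho ((n + i - j) / k))).foldr vsum 0 := by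
  have hmap : (List.range k).map (fun j => ∑ i ∈ Finset.range k, rho ((n + i - j) / k)) =
      (List.range k).map (fun j r => n - (j + k * r)) :=
    List.map_congr_left fun j _ => sum_rho_div_eq n k j hk
  rw [hmap]
  obtain ⟨hp, hc⟩ := isPtnFun_foldr_vsum_and_conjFun_eq
    ((List.range k).map (fun j r => n - (j + k * r))) (by
      simp only [List.mem_map]
      rintro _ ⟨j, -, rfl⟩
      exact isPtnFun_sub_add_mul n k j hk)
  rw [← (isPtnFun_rho n).conjFun_conjFun, ← hp.conjFun_conjFun, hc]
  congr 1
  funext c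
  rw [List.map_map, ← List.sum_toFinset _ List.nodup_range, List.toFinset_range,
     Finset.sum_apply, conjFun_rho]
  calc n - c = ∑ i ∈ Finset.range k, (n - c + i) / k := (sum_range_add_div k hk _).symm
    _ = ∑ j ∈ Finset.range k, (n - c + (k - 1 - j)) / k :=
      (Finset.sum_range_reflect (fun i => (n - c + i) / k) k).symm
    _ = _ := Finset.sum_congr rfl fun j hj =>
      (conjFun_sub_add_mul n k j c (Finset.mem_range.1 hj)).symm
end

section
/- For all partitions λ1, μ1, λ2, μ2 (of arbitrary natural numbers), the generalized blockwise distance satisfies Δ(λ1 +_H μ1, λ2 +_H μ2) ≤ Δ(λ1, λ2) + Δ(μ1, μ2). -/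
/-- The type of all partitions (of arbitrary natural numbers). -/
def Ptn : Type := {f : ℕ → ℕ // IsPtnFun f}

/-- Horizontal sum of partitions: pointwise addition of the part functions. -/
def Ptn.hsum (a b : Ptn) : Ptn :=
  ⟨a.1 + b.1, a.2.1.add b.2.1, by
    obtain ⟨N₁, h₁⟩ := a.2.2
    obtain ⟨N₂, h₂⟩ := b.2.2
    exact ⟨max N₁ N₂, fun i hi => by
      simp [Pi.add_apply, h₁ i (le_trans (le_max_left _ _) hi),
        h₂ i (le_trans (le_max_right _ _) hi)]⟩⟩

/-- `g` is obtained from `f` by adding a single box to the Young diagram. -/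
def AddBox (f g : ℕ → ℕ) : Prop :=
  ∃ i, g i = f i + 1 ∧ ∀ j, j ≠ i → g j = f j

/-- `g` is obtained from `f` by moving a single box of the Young diagram. -/
def MoveBox (f g : ℕ → ℕ) : Prop :=
  ∃ i j, i ≠ j ∧ f i = g i + 1 ∧ g j = f j + 1 ∧ ∀ l, l ≠ i → l ≠ j → g l = f l

/-- Adjacency in the graph on all partitions: one is obtained from the other by
adding, removing, or moving a single box. -/
def PtnAdj (a b : Ptn) : Prop :=
  AddBox a.1 b.1 ∨ AddBox b.1 a.1 ∨ MoveBox a.1 b.1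

/-- The generalized blockwise distance: the graph distance in the graph on all
partitions whose adjacency is `PtnAdj` (length of a shortest walk). -/
noncomputable def pdist (a b : Ptn) : ℕ :=
  sInf {k | ∃ w : ℕ → Ptn, w 0 = a ∧ w k = b ∧ ∀ i, i < k → PtnAdj (w i) (w (i + 1))}

theorem PtnAdj.symm {a b : Ptn} (h : PtnAdj a b) : PtnAdj b a := by
  rcases h with h | h | ⟨i, j, hij, hi, hj, h⟩
  · exact Or.inr (Or.inl h)
  · exact Or.inl h
  · exact Or.inr (Or.inr ⟨j, i, hij.symm, hj, hi, fun l h₁ h₂ => (h l h₂ h₁).symm⟩)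

theorem Ptn.hsum_comm (a b : Ptn) : a.hsum b = b.hsum a :=
  Subtype.ext (add_comm a.1 b.1)

theorem AddBox.add_right {f g : ℕ → ℕ} (h : AddBox f g) (c : ℕ → ℕ) :
    AddBox (f + c) (g + c) := by
  obtain ⟨i, hi, h⟩ := h
  exact ⟨i, by simp only [Pi.add_apply]; omega, fun j hj => by simp [h j hj]⟩

theorem MoveBox.add_right {f g : ℕ → ℕ} (h : MoveBox f g) (c : ℕ → ℕ) :
    MoveBox (f + c) (g + c) := by
  obtain ⟨i, j, hij, hi, hj, h⟩ := h
  exact ⟨i, j, hij, by simp only [Pi.add_apply]; omega, by simp only [Pi.add_apply]; omega,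
    fun l h₁ h₂ => by simp [h l h₁ h₂]⟩

theorem PtnAdj.hsum_right {a b : Ptn} (h : PtnAdj a b) (c : Ptn) :
    PtnAdj (a.hsum c) (b.hsum c) :=
  h.imp (fun h => h.add_right c.1) (Or.imp (fun h => h.add_right c.1) fun h => h.add_right c.1)

/-- There is a walk of length `k` from `a` to `b` in the graph on all partitions. -/
def HasPtnWalk (k : ℕ) (a b : Ptn) : Prop :=
  ∃ w : ℕ → Ptn, w 0 = a ∧ w k = b ∧ ∀ i, i < k → PtnAdj (w i) (w (i + 1))

namespace HasPtnWalk

theorem refl (a : Ptn) : HasPtnWalk 0 a a :=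
  ⟨fun _ => a, rfl, rfl, fun i hi => absurd hi (Nat.not_lt_zero i)⟩

theorem of_adj {a b : Ptn} (h : PtnAdj a b) : HasPtnWalk 1 a b :=
  ⟨fun i => if i = 0 then a else b, rfl, rfl, fun i hi => by
    obtain rfl : i = 0 := by omega
    simpa using h⟩

theorem trans {k l : ℕ} {a b c : Ptn} (h₁ : HasPtnWalk k a b) (h₂ : HasPtnWalk l b c) :
    HasPtnWalk (k + l) a c := by
  obtain ⟨v, v0, vk, hv⟩ := h₁
  obtain ⟨w, w0, wl, hw⟩ := h₂
  refine ⟨fun i => if i < k then v i else w (i - k), ?_, ?_, fun i hi => ?_⟩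
  · rcases Nat.eq_zero_or_pos k with rfl | hk
    · simp [w0, ← vk, v0]
    · simp [hk, v0]
  · simp [wl]
  · rcases lt_trichotomy (i + 1) k with h | h | h
    · simpa [h, Nat.lt_of_succ_lt h] using hv i (Nat.lt_of_succ_lt h)
    · subst h
      simpa [w0, vk] using hv i (Nat.lt_succ_self i)
    · have h₃ : ¬ i < k := by omega
      have h₄ : ¬ i + 1 < k := by omega
      have h₅ : i + 1 - k = i - k + 1 := by omega
      simpa [h₃, h₄, h₅] using hw (i - k) (by omega)

theorem symm {k : ℕ} {a b : Ptn} (h : HasPtnWalk k a b) : HasPtnWalk k b a := by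
  obtain ⟨w, w0, wk, hw⟩ := h
  refine ⟨fun i => w (k - i), by simpa using wk, by simpa using w0, fun i hi => ?_⟩
  have h := hw (k - (i + 1)) (by omega)
  rw [show k - (i + 1) + 1 = k - i by omega] at h
  exact h.symm

theorem hsum_right {k : ℕ} {a b : Ptn} (h : HasPtnWalk k a b) (c : Ptn) :
    HasPtnWalk k (a.hsum c) (b.hsum c) := by
  obtain ⟨w, rfl, rfl, hw⟩ := h
  exact ⟨fun i => (w i).hsum c, rfl, rfl, fun i hi => (hw i hi).hsum_right c⟩

theorem hsum_left {k : ℕ} {a b : Ptn} (h : HasPtnWalk k a b) (c : Ptn) :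
    HasPtnWalk k (c.hsum a) (c.hsum b) := by
  rw [c.hsum_comm a, c.hsum_comm b]
  exact h.hsum_right c

theorem pdist_le {k : ℕ} {a b : Ptn} (h : HasPtnWalk k a b) : pdist a b ≤ k :=
  Nat.sInf_le h

end HasPtnWalk

/-- The empty partition. -/
def Ptn.empty : Ptn := ⟨fun _ => 0, antitone_const, 0, fun _ _ => rfl⟩

theorem Ptn.exists_addBox {a : Ptn} (ha : a ≠ Ptn.empty) : ∃ b : Ptn, AddBox b.1 a.1 := by
  classical
  obtain ⟨f, hf, N, hN⟩ := a
  have hex : ∃ i, f i = 0 := ⟨N, hN N le_rfl⟩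
  have hpos : Nat.find hex ≠ 0 := fun h => ha <| Subtype.ext <| funext fun i =>
    Nat.le_zero.1 ((hf (Nat.zero_le i)).trans_eq ((Nat.find_eq_zero hex).1 h))
  obtain ⟨m, hm⟩ := Nat.exists_eq_succ_of_ne_zero hpos
  have hm₀ : f m ≠ 0 := Nat.find_min hex (by omega)
  have hm₁ : f (m + 1) = 0 := by simpa [hm] using Nat.find_spec hex
  refine ⟨⟨Function.update f m (f m - 1), antitone_nat_of_succ_le fun i => ?_, N, fun i hi => ?_⟩,
    m, ?_, fun j hj => ?_⟩
  · have hi := hf (Nat.le_succ i)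
    simp only [Function.update_apply]
    grind
  · have hi := hN i hi
    simp only [Function.update_apply]
    grind
  · simp only [Function.update_self]
    omega
  · simp [hj]

theorem AddBox.le {f g : ℕ → ℕ} (h : AddBox f g) (j : ℕ) : f j ≤ g j := by
  obtain ⟨i, hi, h⟩ := h
  by_cases hj : j = i
  · subst hj; omega
  · exact (h j hj).ge

theorem AddBox.sum_lt {f g : ℕ → ℕ} (h : AddBox f g) {N : ℕ} (hN : ∀ i, N ≤ i → g i = 0) :
    ∑ i ∈ Finset.range N, f i < ∑ i ∈ Finset.range N, g i := by
  refine Finset.sum_lt_sum (fun j _ => h.le j) ?_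
  obtain ⟨i, hi, -⟩ := h
  refine ⟨i, ?_, by omega⟩
  by_contra hiN
  have := hN i (by simpa using hiN)
  omega

theorem exists_hasPtnWalk_empty (a : Ptn) : ∃ k, HasPtnWalk k a Ptn.empty := by
  obtain ⟨N, hN⟩ := a.2.2
  induction hs : ∑ i ∈ Finset.range N, a.1 i using Nat.strong_induction_on generalizing a with
  | _ s ih =>
    by_cases ha : a = Ptn.empty
    · exact ⟨0, ha ▸ HasPtnWalk.refl a⟩
    · obtain ⟨b, hb⟩ := Ptn.exists_addBox ha
      obtain ⟨k, hk⟩ := ih _ (hs ▸ hb.sum_lt hN) b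
        (fun i hi => Nat.le_zero.1 ((hb.le i).trans_eq (hN i hi))) rfl
      exact ⟨1 + k, (HasPtnWalk.of_adj (Or.inr (Or.inl hb))).trans hk⟩

theorem hasPtnWalk_pdist (a b : Ptn) : HasPtnWalk (pdist a b) a b := by
  obtain ⟨k, hk⟩ := exists_hasPtnWalk_empty a
  obtain ⟨l, hl⟩ := exists_hasPtnWalk_empty b
  exact Nat.sInf_mem (s := {k | HasPtnWalk k a b}) ⟨k + l, hk.trans hl.symm⟩

/-- Subadditivity of the generalized blockwise distance under horizontal sums:
`Δ(λ₁ +_H μ₁, λ₂ +_H μ₂) ≤ Δ(λ₁, λ₂) + Δ(μ₁, μ₂)`. -/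
theorem pdist_hsum_le (l₁ m₁ l₂ m₂ : Ptn) :
    pdist (l₁.hsum m₁) (l₂.hsum m₂) ≤ pdist l₁ l₂ + pdist m₁ m₂ :=
  (((hasPtnWalk_pdist l₁ l₂).hsum_right m₁).trans
    ((hasPtnWalk_pdist m₁ m₂).hsum_left l₂)).pdist_le
end

section
/- Let m ≥ 1 and n = m(m+1)/2, and let λ ⊢ n. If the blockwise distance between λ and the one-row partition (n) is at most m − 1, then λ is dominance-comparable to the staircase ρ_m. -/
/-- The size (number of boxes) of a partition: the sum of its parts. -/
noncomputable def psize (f : ℕ → ℕ) : ℕ := ∑' i, f i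

/-- The one-row partition `(n)`, as a partition. -/
def onerow (n : ℕ) : Ptn :=
  ⟨fun i => if i = 0 then n else 0, by
    constructor
    · intro i j hij
      by_cases hj : j = 0
      · have hi : i = 0 := by omega
        simp [hi, hj]
      · simp [hj]
    · exact ⟨1, fun i hi => by
        have : i ≠ 0 := by omega
        simp [this]⟩⟩

/-- The blockwise distance: graph distance in the graph on partitions whose edges
are single-box moves (which preserve the size, so a walk stays among partitions
of the same number). -/
noncomputable def mdist (a b : Ptn) : ℕ :=
  sInf {k | ∃ w : ℕ → Ptn, w 0 = a ∧ w k = b ∧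
    ∀ i, i < k → MoveBox (w i).1 (w (i + 1)).1}

/-- `f` dominates `g`: every partial sum of parts of `f` is at least that of `g`. -/
def Dominates (f g : ℕ → ℕ) : Prop :=
  ∀ r : ℕ, ∑ i ∈ Finset.range r, g i ≤ ∑ i ∈ Finset.range r, f i

lemma psize_eq_sum_range {f : ℕ → ℕ} {N : ℕ} (hN : ∀ i, N ≤ i → f i = 0) :
    psize f = ∑ i ∈ Finset.range N, f i :=
  tsum_eq_sum fun i hi => hN i (by simpa using hi)

lemma MoveBox.apply_le_succ {f g : ℕ → ℕ} (h : MoveBox f g) (l : ℕ) : g l ≤ f l + 1 := by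
  obtain ⟨i, j, -, hi, hj, hl⟩ := h
  by_cases h1 : l = i
  · subst h1; omega
  by_cases h2 : l = j
  · subst h2; omega
  · have := hl l h1 h2; omega

lemma walk_apply_le {w : ℕ → Ptn} {k : ℕ}
    (hw : ∀ i, i < k → MoveBox (w i).1 (w (i + 1)).1) (l : ℕ) :
    (w k).1 l ≤ (w 0).1 l + k := by
  induction k with
  | zero => simp
  | succ k ih =>
    have h1 := ih fun i hi => hw i (by omega)
    have h2 := (hw k (by omega)).apply_le_succ l
    omega

/-- Moving the last box of the last nonzero row to the first row. -/
lemma exists_moveBox_to_first_row (a : Ptn) {N : ℕ} (hN : ∀ i, N ≤ i → a.1 (i + 1) = 0)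
    (h : a.1 1 ≠ 0) :
    ∃ b : Ptn, MoveBox a.1 b.1 ∧ b.1 0 = a.1 0 + 1 ∧ (∀ i, N ≤ i → b.1 (i + 1) = 0) ∧
      ∑ i ∈ Finset.range N, b.1 (i + 1) + 1 = ∑ i ∈ Finset.range N, a.1 (i + 1) := by
  obtain ⟨f, hf, hz⟩ := a
  dsimp only at hN h ⊢
  obtain ⟨L, hL, hL'⟩ : ∃ L, f (L + 1) ≠ 0 ∧ f (L + 2) = 0 := by
    by_contra! hcon
    have hall : ∀ i, f (i + 1) ≠ 0 := fun i => by
      induction i with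
      | zero => exact h
      | succ i ih => exact hcon i ih
    exact hall N (hN N le_rfl)
  have hLN : L < N := by
    by_contra! hle
    exact hL (hN L hle)
  have hzero : ∀ i, L + 2 ≤ i → f i = 0 := fun i hi => by
    have := hf hi
    omega
  let g : ℕ → ℕ := fun i => if i = 0 then f 0 + 1 else if i = L + 1 then f i - 1 else f i
  have hg : IsPtnFun g := by
    refine ⟨antitone_nat_of_succ_le fun i => ?_, L + 2, fun i hi => ?_⟩
    · have h1 := hf (Nat.le_succ i)
      by_cases hi : i = L + 1
      · simp [g, hi, hL']
      have h3 : f i ≤ g i := by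
        simp only [g, hi, if_false]
        split_ifs with h0
        · simp [h0]
        · exact le_rfl
      have h4 : g (i + 1) ≤ f (i + 1) := by
        simp only [g, Nat.succ_ne_zero, if_false]
        split_ifs <;> omega
      exact h4.trans (h1.trans h3)
    · have := hzero i hi
      simp only [g]
      split_ifs <;> omega
  refine ⟨⟨g, hg⟩, ⟨L + 1, 0, by omega, ?_, by simp [g], fun l h1 h2 => by simp [g, h1, h2]⟩,
    by simp [g], fun i hi => ?_, ?_⟩
  · simp only [g, Nat.succ_ne_zero, if_false, if_true]
    omega
  · have := hN i hi
    simp only [g]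
    split_ifs <;> omega
  · have h1 : ∀ i, f (i + 1) = g (i + 1) + if i = L then 1 else 0 := fun i => by
      by_cases hi : i = L
      · subst hi
        simp only [g]
        simp
        omega
      · simp [g, hi]
    simp [h1, Finset.sum_add_distrib, hLN]

lemma exists_walk_onerow (d : ℕ) : ∀ (a : Ptn) (N : ℕ), (∀ i, N ≤ i → a.1 (i + 1) = 0) →
    ∑ i ∈ Finset.range N, a.1 (i + 1) = d →
    ∃ w : ℕ → Ptn, w 0 = a ∧ w d = onerow (a.1 0 + d) ∧
      ∀ i, i < d → MoveBox (w i).1 (w (i + 1)).1 := by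
  induction d with
  | zero =>
    intro a N hN hs
    refine ⟨fun _ => a, rfl, Subtype.ext (funext fun i => ?_), by simp⟩
    cases i with
    | zero => simp [onerow]
    | succ i =>
      by_cases hi : i < N
      · simpa [onerow] using Finset.sum_eq_zero_iff.1 hs i (Finset.mem_range.2 hi)
      · simpa [onerow] using hN i (by omega)
  | succ d ih =>
    intro a N hN hs
    have h1 : a.1 1 ≠ 0 := fun h0 => by
      rw [Finset.sum_eq_zero fun i _ => ?_] at hs
      · omega
      · have := a.2.1 (show 1 ≤ i + 1 by omega)
        omega
    obtain ⟨b, hab, hb0, hbN, hbs⟩ := exists_moveBox_to_first_row a hN h1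
    obtain ⟨w, hw0, hwd, hw⟩ := ih b N hbN (by omega)
    refine ⟨fun i => Nat.casesOn i a w, rfl, ?_, fun i hi => ?_⟩
    · rw [show a.1 0 + (d + 1) = b.1 0 + d by omega]
      exact hwd
    · cases i with
      | zero => simpa [hw0] using hab
      | succ i => exact hw i (by omega)

lemma le_apply_zero_add_mdist_onerow (a : Ptn) :
    psize a.1 ≤ a.1 0 + mdist a (onerow (psize a.1)) := by
  obtain ⟨N, hN⟩ := a.2.2
  have hsum := psize_eq_sum_range (N := N + 1) fun i hi => hN i (by omega)
  rw [Finset.sum_range_succ'] at hsum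
  obtain ⟨w, hw⟩ := exists_walk_onerow _ a N (fun i hi => hN _ (by omega)) rfl
  rw [add_comm (a.1 0), ← hsum] at hw
  obtain ⟨v, hv0, hvk, hv⟩ := Nat.sInf_mem (s := {k | ∃ w : ℕ → Ptn, w 0 = a ∧
    w k = onerow (psize a.1) ∧ ∀ i, i < k → MoveBox (w i).1 (w (i + 1)).1}) ⟨_, w, hw⟩
  have := walk_apply_le hv 0
  rw [hv0, hvk] at this
  simpa [onerow, mdist] using this

lemma two_mul_sum_rho (m r : ℕ) :
    2 * ∑ i ∈ Finset.range r, rho m i + (m - r) * (m - r + 1) = m * (m + 1) := by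
  induction r with
  | zero => simp
  | succ r ih =>
    rw [Finset.sum_range_succ, ← ih, rho]
    rcases Nat.lt_or_ge r m with h | h
    · obtain ⟨t, rfl⟩ := Nat.exists_eq_add_of_lt h
      rw [show r + t + 1 - r = t + 1 by omega, show r + t + 1 - (r + 1) = t by omega]
      ring
    · simp [Nat.sub_eq_zero_of_le h, Nat.sub_eq_zero_of_le (Nat.le_succ_of_le h)]

lemma sum_rho_add_le (m r : ℕ) :
    ∑ i ∈ Finset.range r, rho m i + (m - r) ≤ m * (m + 1) / 2 := by
  have h := two_mul_sum_rho m r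
  have h2 : 2 * (m - r) ≤ (m - r) * (m - r + 1) := by
    rcases Nat.eq_zero_or_pos (m - r) with h0 | h0
    · simp [h0]
    · nlinarith
  omega

lemma apply_zero_add_le_sum {f : ℕ → ℕ} (hf : Antitone f) (r : ℕ) (hr : f r ≠ 0) :
    f 0 + r ≤ ∑ i ∈ Finset.range (r + 1), f i := by
  induction r with
  | zero => simp
  | succ r ih =>
    have h1 := hf (Nat.le_succ r)
    have h2 := ih (by simp only [Nat.succ_eq_add_one] at h1; omega)
    rw [Finset.sum_range_succ]
    omega

/-- Let `m ≥ 1`, `n = m(m+1)/2`, and `λ ⊢ n`.  If the blockwise distance from `λ`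
to the one-row partition `(n)` is at most `m - 1`, then `λ` is
dominance-comparable to the staircase `ρ_m`. -/
theorem close_to_onerow_dominance (m : ℕ) (hm : 1 ≤ m) (lam : Ptn)
    (hsize : psize lam.1 = m * (m + 1) / 2)
    (hdist : mdist lam (onerow (m * (m + 1) / 2)) ≤ m - 1) :
    Dominates lam.1 (rho m) ∨ Dominates (rho m) lam.1 := by
  left
  have h0 := le_apply_zero_add_mdist_onerow lam
  rw [hsize] at h0
  intro r
  have hrho := sum_rho_add_le m r
  rcases r with _ | r
  · simp
  by_cases hr : lam.1 r = 0
  · have hS : psize lam.1 = ∑ i ∈ Finset.range (r + 1), lam.1 i :=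
      psize_eq_sum_range fun i hi => by
        have := lam.2.1 (show r ≤ i by omega)
        omega
    omega
  · have h1 := apply_zero_add_le_sum lam.2.1 r hr
    omega
end
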